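/- Every indecomposable unimodular hermitian 𝓞-lattice of rank 14 contains exactly 17472 = 2⁶·3·7·13 vectors of norm 3. -/

import Mathlib

noncomputable section
open Matrix Complex
open scoped ComplexOrder

/-- A primitive cube root of unity in `ℂ`. -/
def ω : ℂ := ⟨-1/2, Real.sqrt 3 / 2⟩

/-- The ring of Eisenstein integers `𝓞 = ℤ[ω]`, the ring of integers of `ℚ(√-3)`,
realized as a subalgebra of `ℂ` (so that complex conjugation is available). -/
def 𝓞 : Subalgebra ℤ ℂ := Algebra.adjoin ℤ {ω}

/-- All entries of the matrix are Eisenstein integers. -/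
def EntriesIn {n : ℕ} (H : Matrix (Fin n) (Fin n) ℂ) : Prop := ∀ i j, H i j ∈ 𝓞

/-- `U ∈ GLₙ(𝓞)`: entries in `𝓞`, with a two-sided inverse having entries in `𝓞`. -/
def InGL {n : ℕ} (U : Matrix (Fin n) (Fin n) ℂ) : Prop :=
  EntriesIn U ∧ ∃ V : Matrix (Fin n) (Fin n) ℂ, EntriesIn V ∧ U * V = 1 ∧ V * U = 1

/-- `H` is the Gram matrix of a hermitian `𝓞`-lattice of rank `n`:
entries in `𝓞`, equal to its conjugate transpose, positive definite as a complex matrix. -/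
def IsHermLattice {n : ℕ} (H : Matrix (Fin n) (Fin n) ℂ) : Prop :=
  EntriesIn H ∧ H.IsHermitian ∧ H.PosDef

/-- A unimodular hermitian `𝓞`-lattice: discriminant `det H = 1`. -/
def IsUnimodular {n : ℕ} (H : Matrix (Fin n) (Fin n) ℂ) : Prop :=
  IsHermLattice H ∧ H.det = 1

/-- Isometry of lattices given by Gram matrices: `H' = U * H * U*` for some `U ∈ GLₙ(𝓞)`. -/
def LatIsometric {n : ℕ} (H H' : Matrix (Fin n) (Fin n) ℂ) : Prop :=
  ∃ U : Matrix (Fin n) (Fin n) ℂ, InGL U ∧ H' = U * H * Uᴴ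

/-- A lattice is decomposable if it is isometric to one whose Gram matrix is block
diagonal with two blocks of smaller positive size. -/
def Decomposable {n : ℕ} (H : Matrix (Fin n) (Fin n) ℂ) : Prop :=
  ∃ H' : Matrix (Fin n) (Fin n) ℂ, LatIsometric H H' ∧ ∃ k : ℕ, 0 < k ∧ k < n ∧
    ∀ i j : Fin n, (((i : ℕ) < k ∧ ¬ (j : ℕ) < k) ∨ (¬ (i : ℕ) < k ∧ (j : ℕ) < k)) → H' i j = 0

/-- The norm `x* H x` of a vector. -/
def latNorm {n : ℕ} (H : Matrix (Fin n) (Fin n) ℂ) (x : Fin n → ℂ) : ℂ :=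
  star x ⬝ᵥ H.mulVec x

/-- A vector of `𝓞ⁿ`. -/
def IsLatVec {n : ℕ} (x : Fin n → ℂ) : Prop := ∀ i, x i ∈ 𝓞

/-- A root: a lattice vector of norm 2. -/
def IsRoot {n : ℕ} (H : Matrix (Fin n) (Fin n) ℂ) (x : Fin n → ℂ) : Prop :=
  IsLatVec x ∧ latNorm H x = 2

/-- The lattice contains no roots. -/
def RootFree {n : ℕ} (H : Matrix (Fin n) (Fin n) ℂ) : Prop :=
  ∀ x : Fin n → ℂ, ¬ IsRoot H x

/-- The minimal norm of the lattice is `3`. -/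
def MinNormThree {n : ℕ} (H : Matrix (Fin n) (Fin n) ℂ) : Prop :=
  (∀ x : Fin n → ℂ, IsLatVec x → x ≠ 0 → 3 ≤ (latNorm H x).re) ∧
  (∃ x : Fin n → ℂ, IsLatVec x ∧ latNorm H x = 3)

/-- The order of the automorphism group `{U ∈ GLₙ(𝓞) : U H U* = H}` of the lattice. -/
def autCard {n : ℕ} (H : Matrix (Fin n) (Fin n) ℂ) : ℕ :=
  Nat.card {U : Matrix (Fin n) (Fin n) ℂ // InGL U ∧ U * H * Uᴴ = H}

open scoped Real

/-- Pairs consisting of a positive definite quadratic form on `ℝⁿ` and its dual form, presented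
through successive completion of squares. -/
inductive DualForms : (n : ℕ) → ((Fin n → ℝ) → ℝ) → ((Fin n → ℝ) → ℝ) → Prop
  | zero : DualForms 0 (fun _ ↦ 0) (fun _ ↦ 0)
  | succ {n : ℕ} {Q Q' : (Fin n → ℝ) → ℝ} (h : DualForms n Q Q') {a : ℝ} (ha : 0 < a)
      (c : Fin n → ℝ) :
      DualForms (n + 1) (fun y ↦ a * (y 0 + c ⬝ᵥ Fin.tail y) ^ 2 + Q (Fin.tail y))
        (fun v ↦ a⁻¹ * v 0 ^ 2 + Q' (Fin.tail v - v 0 • c))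

/-- The real vector underlying an integer vector. -/
def castVec {n : ℕ} (x : Fin n → ℤ) : Fin n → ℝ := fun i ↦ (x i : ℝ)

/-- The Gaussian series of `Q` over translates of `ℤⁿ` are bounded uniformly in the translate. -/
def UniformlyGaussSummable {n : ℕ} (Q : (Fin n → ℝ) → ℝ) : Prop :=
  ∀ s : ℝ, 0 < s → ∃ M : ℝ, ∀ b : Fin n → ℝ,
    Summable (fun x : Fin n → ℤ ↦ Real.exp (-s * Q (castVec x + b))) ∧
      ∑' x : Fin n → ℤ, Real.exp (-s * Q (castVec x + b)) ≤ M

theorem tsum_gauss_shift_char {a : ℝ} (ha : 0 < a) (b w : ℝ) :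
    ∑' m : ℤ, cexp (-π * a * (m + b) ^ 2 + 2 * π * I * (w * (m + b))) =
      (1 / √a : ℝ) * ∑' k : ℤ, cexp (-π * a⁻¹ * (k - w) ^ 2 + 2 * π * I * (k * b)) := by
  have ha' : (a : ℂ) ≠ 0 := by exact_mod_cast ha.ne'
  have h := Complex.tsum_exp_neg_quadratic (a := a) (by simpa using ha) (-a * b + I * w)
  have hsq : (a : ℂ) ^ (1 / 2 : ℂ) = (√a : ℝ) := by
    rw [Real.sqrt_eq_rpow, Complex.ofReal_cpow ha.le]; norm_num
  have hl : ∀ m : ℤ, cexp (-π * a * (m + b) ^ 2 + 2 * π * I * (w * (m + b))) =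
      cexp (-π * a * b ^ 2 + 2 * π * I * w * b) *
        cexp (-π * a * m ^ 2 + 2 * π * (-a * b + I * w) * m) := by
    intro m; rw [← Complex.exp_add]; congr 1; ring
  have hr : ∀ k : ℤ, cexp (-π * a⁻¹ * (k - w) ^ 2 + 2 * π * I * (k * b)) =
      cexp (-π * a * b ^ 2 + 2 * π * I * w * b) *
        cexp (-π / a * (k + I * (-a * b + I * w)) ^ 2) := by
    intro k; rw [← Complex.exp_add]; congr 1
    have : (k : ℂ) + I * (-a * b + I * w) = (k - w) - I * a * b := by
      ring_nf; rw [I_sq]; ring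
    rw [this]; push_cast; field_simp; ring_nf; rw [I_sq]; ring
  simp_rw [hl, hr]
  rw [tsum_mul_left, tsum_mul_left, h, hsq]
  push_cast; ring

theorem summable_gauss_shift {s : ℝ} (hs : 0 < s) (b : ℝ) :
    Summable (fun m : ℤ ↦ Real.exp (-s * (m + b) ^ 2)) := by
  have h0 : Summable (fun m : ℤ ↦ Real.exp (-(s / 2) * (m : ℝ) ^ 2)) := by
    have h := summable_pow_mul_jacobiTheta₂_term_bound 0 (T := s / 2 / π) (by positivity) 0
    refine h.congr fun m ↦ ?_
    simp; field_simp
  refine Summable.of_nonneg_of_le (fun _ ↦ (Real.exp_pos _).le) (fun m ↦ ?_)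
    (h0.mul_left (Real.exp (s * b ^ 2)))
  rw [← Real.exp_add]
  apply Real.exp_le_exp.mpr
  nlinarith [mul_nonneg hs.le (sq_nonneg ((m : ℝ) + 2 * b))]

theorem exists_tsum_gauss_shift_le {s : ℝ} (hs : 0 < s) :
    ∃ M : ℝ, ∀ b : ℝ, ∑' m : ℤ, Real.exp (-s * (m + b) ^ 2) ≤ M := by
  have ha : 0 < s / π := by positivity
  refine ⟨(1 / √(s / π)) * ∑' k : ℤ, Real.exp (-(π * (s / π)⁻¹) * (k + 0) ^ 2), fun b ↦ ?_⟩
  have hsum := summable_gauss_shift (s := π * (s / π)⁻¹) (by positivity) 0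
  have h := tsum_gauss_shift_char ha b 0
  have hn : ∀ k : ℤ, ‖cexp (-π * (s / π : ℝ)⁻¹ * (k - (0 : ℝ)) ^ 2 + 2 * π * I * (k * b))‖ =
      Real.exp (-(π * (s / π)⁻¹) * (k + 0) ^ 2) := by
    intro k
    have : (-π * (s / π : ℝ)⁻¹ * (k - (0 : ℝ)) ^ 2 + 2 * π * I * (k * b) : ℂ) =
        ((-(π * (s / π)⁻¹) * (k + 0) ^ 2 : ℝ) : ℂ) + ((2 * π * (k * b) : ℝ) : ℂ) * I := by
      push_cast; ring
    rw [this, Complex.exp_add, norm_mul, Complex.norm_exp_ofReal_mul_I, mul_one,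
      ← Complex.ofReal_exp, Complex.norm_real, Real.norm_of_nonneg (Real.exp_pos _).le]
  have hl : ∑' m : ℤ, cexp (-π * (s / π : ℝ) * (m + b) ^ 2 + 2 * π * I * ((0 : ℝ) * (m + b))) =
      ((∑' m : ℤ, Real.exp (-s * (m + b) ^ 2) : ℝ) : ℂ) := by
    rw [Complex.ofReal_tsum]
    refine tsum_congr fun m ↦ ?_
    push_cast
    congr 1
    field_simp
    ring
  rw [hl] at h
  calc ∑' m : ℤ, Real.exp (-s * (m + b) ^ 2)
      ≤ ‖((∑' m : ℤ, Real.exp (-s * (m + b) ^ 2) : ℝ) : ℂ)‖ := by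
        rw [Complex.norm_real]; exact le_abs_self _
    _ ≤ _ := by
        rw [h, norm_mul, Complex.norm_real, Real.norm_of_nonneg (by positivity)]
        refine mul_le_mul_of_nonneg_left ?_ (by positivity)
        rw [← tsum_congr hn]
        exact norm_tsum_le_tsum_norm (by simpa only [hn] using hsum)

theorem summable_fiberwise_mul {α β : Type*} {g : α → β → ℝ} {h : α → ℝ} {M N : ℝ}
    (hg0 : ∀ x y, 0 ≤ g x y) (hh0 : ∀ x, 0 ≤ h x)
    (hg : ∀ x, Summable (g x)) (hgM : ∀ x, ∑' y, g x y ≤ M)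
    (hh : Summable h) (hN : ∑' x, h x ≤ N) :
    Summable (fun p : α × β ↦ h p.1 * g p.1 p.2) ∧
      ∑' p : α × β, h p.1 * g p.1 p.2 ≤ |M| * N := by
  have hle : ∀ x, ∑' y, h x * g x y ≤ |M| * h x := fun x ↦ by
    rw [tsum_mul_left, mul_comm]
    exact mul_le_mul_of_nonneg_right ((hgM x).trans (le_abs_self M)) (hh0 x)
  have hs : Summable (fun x ↦ ∑' y, h x * g x y) :=
    Summable.of_nonneg_of_le (fun x ↦ tsum_nonneg fun y ↦ mul_nonneg (hh0 x) (hg0 x y))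
      hle (hh.mul_left |M|)
  have hfib : ∀ x, Summable (fun y ↦ h x * g x y) := fun x ↦ (hg x).mul_left (h x)
  have hnn : 0 ≤ fun p : α × β ↦ h p.1 * g p.1 p.2 := fun p ↦
    mul_nonneg (hh0 p.1) (hg0 p.1 p.2)
  have hsum : Summable (fun p : α × β ↦ h p.1 * g p.1 p.2) :=
    (summable_prod_of_nonneg hnn).mpr ⟨hfib, hs⟩
  refine ⟨hsum, ?_⟩
  rw [hsum.tsum_prod' hfib]
  have h1 : ∑' x, ∑' y, h x * g x y ≤ ∑' x, |M| * h x :=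
    hs.tsum_le_tsum hle (hh.mul_left |M|)
  rw [tsum_mul_left] at h1
  exact h1.trans (mul_le_mul_of_nonneg_left hN (abs_nonneg M))

/-- Splitting off the first coordinate of an integer vector. -/
def consIntEquiv (n : ℕ) : ℤ × (Fin n → ℤ) ≃ (Fin (n + 1) → ℤ) :=
  Fin.consEquiv (fun _ ↦ ℤ)

theorem castVec_consIntEquiv_zero {n : ℕ} (p : ℤ × (Fin n → ℤ)) :
    castVec (consIntEquiv n p) 0 = p.1 := rfl

theorem tail_castVec_consIntEquiv {n : ℕ} (p : ℤ × (Fin n → ℤ)) :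
    Fin.tail (castVec (consIntEquiv n p)) = castVec p.2 := rfl

theorem UniformlyGaussSummable.succ {n : ℕ} {Q : (Fin n → ℝ) → ℝ}
    (h : UniformlyGaussSummable Q) {a : ℝ} (ha : 0 < a) (c : Fin n → ℝ) :
    UniformlyGaussSummable
      (fun y : Fin (n + 1) → ℝ ↦ a * (y 0 + c ⬝ᵥ Fin.tail y) ^ 2 + Q (Fin.tail y)) := by
  intro s hs
  obtain ⟨N, hN⟩ := h s hs
  obtain ⟨M, hM⟩ := exists_tsum_gauss_shift_le (mul_pos hs ha)
  refine ⟨|M| * N, fun b ↦ ?_⟩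
  have key := summable_fiberwise_mul
    (g := fun (x : Fin n → ℤ) (m : ℤ) ↦
      Real.exp (-(s * a) * (m + (b 0 + c ⬝ᵥ (castVec x + Fin.tail b))) ^ 2))
    (h := fun x ↦ Real.exp (-s * Q (castVec x + Fin.tail b)))
    (fun _ _ ↦ (Real.exp_pos _).le) (fun _ ↦ (Real.exp_pos _).le)
    (fun x ↦ summable_gauss_shift (mul_pos hs ha) _) (fun x ↦ hM _)
    (hN (Fin.tail b)).1 (hN (Fin.tail b)).2
  have he : ∀ p : (Fin n → ℤ) × ℤ,
      Real.exp (-s * Q (castVec p.1 + Fin.tail b)) *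
        Real.exp (-(s * a) * (p.2 + (b 0 + c ⬝ᵥ (castVec p.1 + Fin.tail b))) ^ 2) =
      Real.exp (-s * (a * ((castVec (consIntEquiv n p.swap) + b) 0 +
        c ⬝ᵥ Fin.tail (castVec (consIntEquiv n p.swap) + b)) ^ 2 +
          Q (Fin.tail (castVec (consIntEquiv n p.swap) + b)))) := by
    intro p
    have h1 : Fin.tail (castVec (consIntEquiv n p.swap) + b) = castVec p.1 + Fin.tail b := rfl
    have h2 : (castVec (consIntEquiv n p.swap) + b) 0 = p.2 + b 0 := rfl
    rw [h1, h2, ← Real.exp_add]; congr 1; ring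
  simp only [he] at key
  constructor
  · exact ((Equiv.prodComm _ _).trans (consIntEquiv n)).summable_iff.mp key.1
  · rw [← ((Equiv.prodComm _ _).trans (consIntEquiv n)).tsum_eq]
    exact key.2

theorem UniformlyGaussSummable.succ_dual {n : ℕ} {Q : (Fin n → ℝ) → ℝ}
    (h : UniformlyGaussSummable Q) {a : ℝ} (ha : 0 < a) (c : Fin n → ℝ) :
    UniformlyGaussSummable
      (fun v : Fin (n + 1) → ℝ ↦ a * v 0 ^ 2 + Q (Fin.tail v - v 0 • c)) := by
  intro s hs
  obtain ⟨N, hN⟩ := h s hs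
  obtain ⟨M, hM⟩ := exists_tsum_gauss_shift_le (mul_pos hs ha)
  refine ⟨|N| * M, fun b ↦ ?_⟩
  have key := summable_fiberwise_mul
    (g := fun (m : ℤ) (x : Fin n → ℤ) ↦
      Real.exp (-s * Q (castVec x + (Fin.tail b - (m + b 0) • c))))
    (h := fun m : ℤ ↦ Real.exp (-(s * a) * (m + b 0) ^ 2))
    (fun _ _ ↦ (Real.exp_pos _).le) (fun _ ↦ (Real.exp_pos _).le)
    (fun m ↦ (hN _).1) (fun m ↦ (hN _).2)
    (summable_gauss_shift (mul_pos hs ha) _) (hM (b 0))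
  have he : ∀ p : ℤ × (Fin n → ℤ),
      Real.exp (-(s * a) * (p.1 + b 0) ^ 2) *
      Real.exp (-s * Q (castVec p.2 + (Fin.tail b - (p.1 + b 0) • c))) =
      Real.exp (-s * (a * (castVec (consIntEquiv n p) + b) 0 ^ 2 +
          Q (Fin.tail (castVec (consIntEquiv n p) + b) -
            (castVec (consIntEquiv n p) + b) 0 • c))) := by
    intro p
    have h1 : Fin.tail (castVec (consIntEquiv n p) + b) = castVec p.2 + Fin.tail b := rfl
    have h2 : (castVec (consIntEquiv n p) + b) 0 = p.1 + b 0 := rfl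
    rw [h1, h2, ← Real.exp_add, add_sub_assoc]; congr 1; ring
  simp only [he] at key
  constructor
  · exact (consIntEquiv n).summable_iff.mp key.1
  · rw [← (consIntEquiv n).tsum_eq]
    exact key.2

theorem uniformlyGaussSummable_zero :
    UniformlyGaussSummable (fun _ : Fin 0 → ℝ ↦ 0) := fun s _ ↦
  ⟨∑' _ : Fin 0 → ℤ, Real.exp (-s * 0), fun _ ↦
    ⟨summable_of_hasFiniteSupport (Set.toFinite _), le_rfl⟩⟩

theorem DualForms.uniformlyGaussSummable {n : ℕ} {Q Q' : (Fin n → ℝ) → ℝ}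
    (h : DualForms n Q Q') : UniformlyGaussSummable Q ∧ UniformlyGaussSummable Q' := by
  induction h with
  | zero => exact ⟨uniformlyGaussSummable_zero, uniformlyGaussSummable_zero⟩
  | succ h ha c ih => exact ⟨ih.1.succ ha c, ih.2.succ_dual (inv_pos.mpr ha) c⟩

theorem norm_cexp_gauss_char (u v : ℝ) : ‖cexp ((u : ℂ) + 2 * π * I * (v : ℂ))‖ = Real.exp u := by
  have : (u : ℂ) + 2 * π * I * (v : ℂ) = (u : ℂ) + ((2 * π * v : ℝ) : ℂ) * I := by
    push_cast; ring
  rw [this, Complex.exp_add, norm_mul, Complex.norm_exp_ofReal_mul_I, mul_one,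
      ← Complex.ofReal_exp, Complex.norm_real, Real.norm_of_nonneg (Real.exp_pos _).le]

/-- Poisson summation for Gaussians of positive definite quadratic forms, with a translation and a
character. -/
theorem DualForms.tsum_gauss {n : ℕ} {Q Q' : (Fin n → ℝ) → ℝ} (h : DualForms n Q Q') :
    ∃ C : ℝ, 0 < C ∧ ∀ t : ℝ, 0 < t → ∀ b w : Fin n → ℝ,
      ∑' x : Fin n → ℤ, cexp ((-(π * t) * Q (castVec x + b) : ℝ) +
          2 * π * I * ((w ⬝ᵥ (castVec x + b) : ℝ) : ℂ)) =
        (C * (1 / √t) ^ n : ℝ) * ∑' k : Fin n → ℤ,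
          cexp ((-(π * t⁻¹) * Q' (castVec k - w) : ℝ) +
            2 * π * I * ((castVec k ⬝ᵥ b : ℝ) : ℂ)) := by
  induction h with
  | zero => exact ⟨1, one_pos, fun t ht b w ↦ by simp⟩
  | @succ n Q Q' h a ha c ih =>
    obtain ⟨C, hC, ih⟩ := ih
    refine ⟨1 / √a * C, by positivity, fun t ht b w ↦ ?_⟩
    have hta : 0 < t * a := mul_pos ht ha
    set b' := Fin.tail b with hb'
    set w' := Fin.tail w with hw'
    have hdot : ∀ u v : Fin (n + 1) → ℝ, u ⬝ᵥ v = u 0 * v 0 + Fin.tail u ⬝ᵥ Fin.tail v :=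
      fun u v ↦ Fin.sum_univ_succ _
    have hQ := ((h.succ ha c).uniformlyGaussSummable.1 (π * t) (by positivity))
    have hQ' := ((h.succ ha c).uniformlyGaussSummable.2 (π * t⁻¹) (by positivity))
    obtain ⟨_, hQ⟩ := hQ
    obtain ⟨_, hQ'⟩ := hQ'
    set E : (Fin n → ℤ) → ℂ := fun x ↦ cexp ((-(π * t) * Q (castVec x + b') : ℝ) +
      2 * π * I * (((w' - w 0 • c) ⬝ᵥ (castVec x + b') : ℝ) : ℂ)) with hE
    have hl : ∀ p : (Fin n → ℤ) × ℤ,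
        cexp ((-(π * t) * (a * ((castVec (consIntEquiv n p.swap) + b) 0 +
            c ⬝ᵥ Fin.tail (castVec (consIntEquiv n p.swap) + b)) ^ 2 +
            Q (Fin.tail (castVec (consIntEquiv n p.swap) + b))) : ℝ) +
          2 * π * I * ((w ⬝ᵥ (castVec (consIntEquiv n p.swap) + b) : ℝ) : ℂ)) =
        E p.1 * cexp (-π * (t * a : ℝ) * (p.2 + (b 0 + c ⬝ᵥ (castVec p.1 + b') : ℝ)) ^ 2 +
          2 * π * I * ((w 0 : ℝ) * (p.2 + (b 0 + c ⬝ᵥ (castVec p.1 + b') : ℝ)))) := by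
      intro p
      have h1 : Fin.tail (castVec (consIntEquiv n p.swap) + b) = castVec p.1 + b' := rfl
      have h2 : (castVec (consIntEquiv n p.swap) + b) 0 = p.2 + b 0 := rfl
      rw [hdot, h1, h2, hE, ← Complex.exp_add, sub_dotProduct, smul_dotProduct]
      congr 1
      push_cast [smul_eq_mul]
      ring
    -- the summand after summing over the first coordinate
    set G : ℤ → ℂ := fun k ↦ cexp (-π * (t * a : ℝ)⁻¹ * (k - w 0) ^ 2 + 2 * π * I * (k * b 0))
      with hG
    set F : ℤ → (Fin n → ℤ) → ℂ := fun k x ↦ cexp ((-(π * t) * Q (castVec x + b') : ℝ) +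
      2 * π * I * (((w' + (k - w 0) • c) ⬝ᵥ (castVec x + b') : ℝ) : ℂ)) with hF
    have hmid : ∀ (x : Fin n → ℤ) (k : ℤ),
        E x * cexp (-π * (t * a : ℝ)⁻¹ * (k - w 0) ^ 2 +
          2 * π * I * (k * (b 0 + c ⬝ᵥ (castVec x + b') : ℝ))) = G k * F k x := by
      intro x k
      simp only [hE, hG, hF]
      rw [← Complex.exp_add, ← Complex.exp_add, sub_dotProduct, smul_dotProduct, add_dotProduct,
        smul_dotProduct]
      congr 1
      push_cast [smul_eq_mul]
      ring
    have hr : ∀ p : ℤ × (Fin n → ℤ),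
        cexp ((-(π * t⁻¹) * (a⁻¹ * (castVec (consIntEquiv n p) - w) 0 ^ 2 +
            Q' (Fin.tail (castVec (consIntEquiv n p) - w) -
              (castVec (consIntEquiv n p) - w) 0 • c)) : ℝ) +
          2 * π * I * ((castVec (consIntEquiv n p) ⬝ᵥ b : ℝ) : ℂ)) =
        G p.1 * cexp ((-(π * t⁻¹) * Q' (castVec p.2 - (w' + (p.1 - w 0) • c)) : ℝ) +
          2 * π * I * ((castVec p.2 ⬝ᵥ b' : ℝ) : ℂ)) := by
      intro p
      have h1 : Fin.tail (castVec (consIntEquiv n p) - w) = castVec p.2 - w' := rfl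
      have h2 : (castVec (consIntEquiv n p) - w) 0 = p.1 - w 0 := rfl
      rw [hdot, h1, h2, hG, ← Complex.exp_add, tail_castVec_consIntEquiv,
        castVec_consIntEquiv_zero, sub_add_eq_sub_sub]
      congr 1
      push_cast
      rw [mul_inv]
      ring
    have hsumL : Summable (fun p : (Fin n → ℤ) × ℤ ↦
        E p.1 * cexp (-π * (t * a : ℝ) * (p.2 + (b 0 + c ⬝ᵥ (castVec p.1 + b') : ℝ)) ^ 2 +
          2 * π * I * ((w 0 : ℝ) * (p.2 + (b 0 + c ⬝ᵥ (castVec p.1 + b') : ℝ))))) := by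
      simp_rw [← hl]
      apply Summable.of_norm
      simp_rw [norm_cexp_gauss_char]
      exact ((Equiv.prodComm _ _).trans (consIntEquiv n)).summable_iff.mpr (hQ b).1
    have hsumR : Summable (fun p : ℤ × (Fin n → ℤ) ↦
        G p.1 * cexp ((-(π * t⁻¹) * Q' (castVec p.2 - (w' + (p.1 - w 0) • c)) : ℝ) +
          2 * π * I * ((castVec p.2 ⬝ᵥ b' : ℝ) : ℂ))) := by
      simp_rw [← hr]
      apply Summable.of_norm
      simp_rw [norm_cexp_gauss_char]
      simp_rw [sub_eq_add_neg (castVec _) w]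
      exact (consIntEquiv n).summable_iff.mpr (hQ' (-w)).1
    have hsumM : Summable (Function.uncurry fun (k : ℤ) (x : Fin n → ℤ) ↦ G k * F k x) := by
      apply Summable.of_norm
      obtain ⟨_, hq⟩ := h.uniformlyGaussSummable.1 (π * t) (by positivity)
      have h1 := summable_gauss_shift (s := π * (t * a)⁻¹) (by positivity) (-w 0)
      refine (h1.mul_of_nonneg (hq b').1 (fun _ ↦ (Real.exp_pos _).le)
        (fun _ ↦ (Real.exp_pos _).le)).congr fun p ↦ ?_
      have hGn : ‖G p.1‖ = Real.exp (-(π * (t * a)⁻¹) * (p.1 + -w 0) ^ 2) := by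
        rw [← norm_cexp_gauss_char _ (p.1 * b 0)]
        simp only [hG]
        congr 2
        push_cast
        ring
      rw [Function.uncurry, norm_mul, hGn, hF, norm_cexp_gauss_char]
    rw [← ((Equiv.prodComm _ _).trans (consIntEquiv n)).tsum_eq,
      ← (consIntEquiv n).tsum_eq]
    calc _ = ∑' p : (Fin n → ℤ) × ℤ, E p.1 *
            cexp (-π * (t * a : ℝ) * (p.2 + (b 0 + c ⬝ᵥ (castVec p.1 + b') : ℝ)) ^ 2 +
            2 * π * I * ((w 0 : ℝ) * (p.2 + (b 0 + c ⬝ᵥ (castVec p.1 + b') : ℝ)))) :=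
          tsum_congr hl
      _ = ∑' x : Fin n → ℤ, ((1 / √(t * a) : ℝ) : ℂ) * ∑' k : ℤ, G k * F k x := by
          rw [hsumL.tsum_prod]
          refine tsum_congr fun x ↦ ?_
          dsimp only
          rw [tsum_mul_left, tsum_gauss_shift_char hta, mul_left_comm, ← tsum_mul_left]
          simp_rw [← hmid]
      _ = ((1 / √(t * a) : ℝ) : ℂ) * ∑' k : ℤ, ∑' x : Fin n → ℤ, G k * F k x := by
          rw [tsum_mul_left, hsumM.tsum_comm]
      _ = ((1 / √(t * a) : ℝ) : ℂ) * ((C * (1 / √t) ^ n : ℝ) *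
            ∑' k : ℤ, ∑' k' : Fin n → ℤ, G k *
              cexp ((-(π * t⁻¹) * Q' (castVec k' - (w' + (k - w 0) • c)) : ℝ) +
                2 * π * I * ((castVec k' ⬝ᵥ b' : ℝ) : ℂ))) := by
          congr 1
          rw [← tsum_mul_left]
          refine tsum_congr fun k ↦ ?_
          rw [tsum_mul_left, tsum_mul_left, hF, ih t ht b' _]
          ring
      _ = _ := by
          simp_rw [hr]
          rw [hsumR.tsum_prod, ← mul_assoc, ← Complex.ofReal_mul]
          congr 2
          have h1 : √t ≠ 0 := (Real.sqrt_pos.mpr ht).ne'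
          have h2 : √a ≠ 0 := (Real.sqrt_pos.mpr ha).ne'
          rw [Real.sqrt_mul ht.le, pow_succ]
          field_simp

/-- The embedding `ℝⁿ → ℝⁿ⁺¹` with first coordinate `-(c ⬝ᵥ y)`. -/
def shearLift {n : ℕ} (c : Fin n → ℝ) : (Fin n → ℝ) →ₗ[ℝ] (Fin (n + 1) → ℝ) where
  toFun y := Fin.cons (-(c ⬝ᵥ y)) y
  map_add' x y := by
    funext i
    refine Fin.cases ?_ (fun j ↦ ?_) i
    · simp [dotProduct_add]; ring
    · simp
  map_smul' r y := by
    funext i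
    refine Fin.cases ?_ (fun j ↦ ?_) i
    · simp [dotProduct_smul]
    · simp

theorem eq_smul_single_add_shearLift {n : ℕ} (c : Fin n → ℝ) (y : Fin (n + 1) → ℝ) :
    y = (y 0 + c ⬝ᵥ Fin.tail y) • Pi.single 0 1 + shearLift c (Fin.tail y) := by
  funext i
  refine Fin.cases ?_ (fun j ↦ ?_) i
  · simp [shearLift]
  · simp [shearLift, Fin.tail]

theorem shearLift_single {n : ℕ} (c : Fin n → ℝ) (j : Fin n) :
    (Pi.single j.succ 1 : Fin (n + 1) → ℝ) =
      shearLift c (Pi.single j 1) + c j • Pi.single 0 1 := by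
  funext i
  refine Fin.cases ?_ (fun k ↦ ?_) i
  · simp [shearLift]
  · simp [shearLift, Pi.single_apply]

theorem exists_dualForms {n : ℕ} (B : LinearMap.BilinForm ℝ (Fin n → ℝ))
    (hsymm : ∀ x y, B x y = B y x) (hpos : ∀ x, x ≠ 0 → 0 < B x x) :
    ∃ Q' : (Fin n → ℝ) → ℝ, DualForms n (fun y ↦ B y y) Q' ∧
      ∀ y, Q' (fun j ↦ B (Pi.single j 1) y) = B y y := by
  induction n with
  | zero =>
    have h0 : ∀ y : Fin 0 → ℝ, B y y = 0 := fun y ↦ by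
      rw [Subsingleton.elim y 0, map_zero]
    refine ⟨fun _ ↦ 0, ?_, fun y ↦ (h0 y).symm⟩
    simp_rw [h0]
    exact DualForms.zero
  | succ n ih =>
    set e : Fin (n + 1) → ℝ := Pi.single 0 1 with he
    set a := B e e with ha_def
    have ha : 0 < a := hpos e (by simp [he])
    set c : Fin n → ℝ := fun j ↦ B e (Pi.single j.succ 1) / a with hc
    have horth : ∀ y', B e (shearLift c y') = 0 := by
      intro y'
      have h1 : shearLift c y' = ∑ i, (shearLift c y') i • (Pi.single i 1 : Fin (n + 1) → ℝ) :=
        pi_eq_sum_univ' _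
      rw [h1, map_sum, Fin.sum_univ_succ]
      simp only [map_smul, smul_eq_mul]
      have h2 : (shearLift c y') 0 = -(c ⬝ᵥ y') := rfl
      have h3 : ∀ j : Fin n, (shearLift c y') j.succ = y' j := fun j ↦ rfl
      simp_rw [h2, h3]
      rw [← he, ← ha_def, dotProduct, neg_mul, Finset.sum_mul, neg_add_eq_zero]
      refine Finset.sum_congr rfl fun j _ ↦ ?_
      simp only [hc]
      field_simp
    have horth' : ∀ y', B (shearLift c y') e = 0 := fun y' ↦ by rw [hsymm, horth]
    set S : LinearMap.BilinForm ℝ (Fin n → ℝ) := B.compl₁₂ (shearLift c) (shearLift c) with hS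
    have hSapp : ∀ x y, S x y = B (shearLift c x) (shearLift c y) := fun x y ↦ rfl
    have hinj : ∀ y', y' ≠ 0 → shearLift c y' ≠ 0 := fun y' hy h ↦ hy (by
      funext j; exact congrFun h j.succ)
    obtain ⟨Q', hQ', hdual⟩ := ih S (fun x y ↦ by rw [hSapp, hSapp, hsymm])
      (fun x hx ↦ hpos _ (hinj x hx))
    have hv0 : ∀ y, B e y = a * (y 0 + c ⬝ᵥ Fin.tail y) := by
      intro y
      conv_lhs => rw [eq_smul_single_add_shearLift c y]
      rw [map_add, map_smul, horth, ← he, ← ha_def, smul_eq_mul, add_zero, mul_comm]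
    have hsplit : ∀ y, B y y = a * (y 0 + c ⬝ᵥ Fin.tail y) ^ 2 + S (Fin.tail y) (Fin.tail y) := by
      intro y
      conv_lhs => rw [eq_smul_single_add_shearLift c y]
      rw [← he]
      simp only [map_add, map_smul, LinearMap.add_apply, LinearMap.smul_apply, horth, horth',
        smul_eq_mul, ← ha_def, hSapp]
      ring
    refine ⟨fun v ↦ a⁻¹ * v 0 ^ 2 + Q' (Fin.tail v - v 0 • c), ?_, ?_⟩
    · simp_rw [hsplit]
      exact hQ'.succ ha c
    · intro y
      have hvt : (Fin.tail (fun j ↦ B (Pi.single j 1) y) - B (Pi.single 0 1) y • c) =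
          fun j ↦ S (Pi.single j 1) (Fin.tail y) := by
        funext j
        simp only [Pi.sub_apply, Fin.tail, Pi.smul_apply, smul_eq_mul, ← he]
        rw [shearLift_single c j, ← he, map_add, map_smul, LinearMap.add_apply,
          LinearMap.smul_apply, smul_eq_mul]
        conv_lhs => enter [1, 1]; rw [eq_smul_single_add_shearLift c y]
        rw [← he, map_add, map_smul, horth', hSapp]
        simp only [smul_zero, zero_add]
        ring
      dsimp only
      rw [hvt, hdual, hsplit, ← he, hv0]
      field_simp

theorem omega_re : ω.re = -1 / 2 := rfl

theorem omega_im : ω.im = √3 / 2 := rfl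

theorem omega_sq : ω ^ 2 = -1 - ω := by
  have h := Real.mul_self_sqrt (show (0 : ℝ) ≤ 3 by norm_num)
  apply Complex.ext
  · simp [sq, omega_re, omega_im]; nlinarith
  · simp [sq, omega_re, omega_im]; ring

theorem star_omega : star ω = -1 - ω := by
  apply Complex.ext
  · simp [omega_re]; norm_num
  · simp [omega_im]

theorem omega_mem : ω ∈ 𝓞 := Algebra.subset_adjoin rfl

theorem mem_eisenstein_iff {z : ℂ} : z ∈ 𝓞 ↔ ∃ m n : ℤ, z = m + n * ω := by
  constructor
  · intro h
    induction h using Algebra.adjoin_induction with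
    | mem x hx => exact ⟨0, 1, by simp [Set.mem_singleton_iff.mp hx]⟩
    | algebraMap r => exact ⟨r, 0, by simp⟩
    | add x y _ _ hx hy =>
      obtain ⟨a, b, rfl⟩ := hx
      obtain ⟨c, d, rfl⟩ := hy
      exact ⟨a + c, b + d, by push_cast; ring⟩
    | mul x y _ _ hx hy =>
      obtain ⟨a, b, rfl⟩ := hx
      obtain ⟨c, d, rfl⟩ := hy
      refine ⟨a * c - b * d, a * d + b * c - b * d, ?_⟩
      push_cast
      linear_combination (b * d : ℂ) * omega_sq
  · rintro ⟨m, n, rfl⟩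
    exact add_mem (intCast_mem _ m) (mul_mem (intCast_mem _ n) omega_mem)

theorem star_mem_eisenstein {z : ℂ} (hz : z ∈ 𝓞) : star z ∈ 𝓞 := by
  obtain ⟨m, n, rfl⟩ := mem_eisenstein_iff.mp hz
  refine mem_eisenstein_iff.mpr ⟨m - n, -n, ?_⟩
  rw [star_add, star_mul, star_omega]
  simp
  ring

theorem re_add_mul_omega (a b : ℝ) : ((a : ℂ) + b * ω).re = a - b / 2 := by
  simp [omega_re]; ring

theorem im_add_mul_omega (a b : ℝ) : ((a : ℂ) + b * ω).im = b * (√3 / 2) := by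
  simp [omega_im]

theorem exists_intCast_of_mem_eisenstein {z : ℂ} (hz : z ∈ 𝓞) (him : z.im = 0) :
    ∃ m : ℤ, z = m := by
  obtain ⟨m, n, rfl⟩ := mem_eisenstein_iff.mp hz
  have h := im_add_mul_omega m n
  push_cast at h
  rw [him] at h
  have hn : (n : ℝ) = 0 := by
    have h3 : √3 / 2 ≠ 0 := by positivity
    exact (mul_eq_zero.mp h.symm).resolve_right h3
  have : n = 0 := by exact_mod_cast hn
  exact ⟨m, by simp [this]⟩

/-- Real coordinates on `ℂⁿ` with respect to the basis `1, ω` of `ℂ`. -/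
def eisVec {n : ℕ} : (Fin (n * 2) → ℝ) →ₗ[ℝ] (Fin n → ℂ) where
  toFun y i := (y (finProdFinEquiv (i, 0)) : ℂ) + y (finProdFinEquiv (i, 1)) * ω
  map_add' x y := by funext i; simp; ring
  map_smul' r y := by funext i; simp; ring

theorem eisVec_apply {n : ℕ} (y : Fin (n * 2) → ℝ) (i : Fin n) :
    eisVec y i = (y (finProdFinEquiv (i, 0)) : ℂ) + y (finProdFinEquiv (i, 1)) * ω := rfl

theorem ofReal_add_mul_omega_injective {a b c d : ℝ} (h : (a : ℂ) + b * ω = c + d * ω) :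
    a = c ∧ b = d := by
  have him := congrArg Complex.im h
  have hre := congrArg Complex.re h
  rw [im_add_mul_omega, im_add_mul_omega] at him
  rw [re_add_mul_omega, re_add_mul_omega] at hre
  have hb : b = d := mul_right_cancel₀ (by positivity : √3 / 2 ≠ 0) him
  subst hb
  exact ⟨by linarith, rfl⟩

theorem fin_mul_two_ext {n : ℕ} {α : Type*} {x y : Fin (n * 2) → α}
    (h0 : ∀ i, x (finProdFinEquiv (i, 0)) = y (finProdFinEquiv (i, 0)))
    (h1 : ∀ i, x (finProdFinEquiv (i, 1)) = y (finProdFinEquiv (i, 1))) : x = y := by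
  funext j
  obtain ⟨⟨i, k⟩, rfl⟩ := finProdFinEquiv.surjective j
  fin_cases k
  · exact h0 i
  · exact h1 i

theorem eisVec_injective {n : ℕ} : Function.Injective (eisVec (n := n)) := by
  intro x y h
  have hi : ∀ i, x (finProdFinEquiv (i, 0)) = y (finProdFinEquiv (i, 0)) ∧
      x (finProdFinEquiv (i, 1)) = y (finProdFinEquiv (i, 1)) := fun i ↦
    ofReal_add_mul_omega_injective (congrFun h i)
  exact fin_mul_two_ext (fun i ↦ (hi i).1) (fun i ↦ (hi i).2)

/-- The vector indexed by `Fin (n * 2)` with the given even and odd entries. -/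
def interleave {n : ℕ} {α : Type*} (u v : Fin n → α) : Fin (n * 2) → α := fun j ↦
  if (finProdFinEquiv.symm j).2 = 0 then u (finProdFinEquiv.symm j).1
  else v (finProdFinEquiv.symm j).1

@[simp] theorem interleave_zero {n : ℕ} {α : Type*} (u v : Fin n → α) (i : Fin n) :
    interleave u v (finProdFinEquiv (i, 0)) = u i := by simp [interleave]

@[simp] theorem interleave_one {n : ℕ} {α : Type*} (u v : Fin n → α) (i : Fin n) :
    interleave u v (finProdFinEquiv (i, 1)) = v i := by simp [interleave]

theorem eisVec_surjective {n : ℕ} : Function.Surjective (eisVec (n := n)) := by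
  intro z
  refine ⟨interleave (fun i ↦ (z i).re + (z i).im / √3) (fun i ↦ 2 * (z i).im / √3), ?_⟩
  funext i
  rw [eisVec_apply, interleave_zero, interleave_one]
  apply Complex.ext
  · rw [re_add_mul_omega]; ring
  · rw [im_add_mul_omega]; field_simp

/-- Integer coordinates on the lattice `𝓞ⁿ`. -/
def latVecEquiv (n : ℕ) : (Fin (n * 2) → ℤ) ≃ {x : Fin n → ℂ // IsLatVec x} :=
  Equiv.ofBijective
    (fun k ↦ ⟨eisVec (castVec k), fun i ↦ mem_eisenstein_iff.mpr
      ⟨k (finProdFinEquiv (i, 0)), k (finProdFinEquiv (i, 1)), by simp [eisVec_apply, castVec]⟩⟩)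
    ⟨fun k l h ↦ by
      have h1 : castVec k = castVec l := eisVec_injective (Subtype.ext_iff.mp h)
      funext j
      have h2 := congrFun h1 j
      exact Int.cast_injective h2, fun x ↦ by
      choose m l h using fun i ↦ mem_eisenstein_iff.mp (x.2 i)
      refine ⟨interleave m l, Subtype.ext (funext fun i ↦ ?_)⟩
      simp [eisVec_apply, castVec, h]⟩

theorem latVecEquiv_apply {n : ℕ} (k : Fin (n * 2) → ℤ) :
    (latVecEquiv n k : Fin n → ℂ) = eisVec (castVec k) := rfl

/-- The integer vector with coordinates exchanged in pairs, with a sign. -/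
def swapPairs (n : ℕ) : (Fin (n * 2) → ℤ) ≃ (Fin (n * 2) → ℤ) where
  toFun k := interleave (fun i ↦ k (finProdFinEquiv (i, 1))) (fun i ↦ -k (finProdFinEquiv (i, 0)))
  invFun k := interleave (fun i ↦ -k (finProdFinEquiv (i, 1))) (fun i ↦ k (finProdFinEquiv (i, 0)))
  left_inv k := fin_mul_two_ext (by simp) (by simp)
  right_inv k := fin_mul_two_ext (by simp) (by simp)

/-- The real bilinear form `(y, z) ↦ (2 / √3) Re ⟨y, z⟩` in integral coordinates. -/
def traceForm {n : ℕ} (H : Matrix (Fin n) (Fin n) ℂ) : LinearMap.BilinForm ℝ (Fin (n * 2) → ℝ) :=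
  LinearMap.mk₂ ℝ (fun y z ↦ 2 / √3 * (star (eisVec y) ⬝ᵥ H *ᵥ eisVec z).re)
    (fun x y z ↦ by simp [add_dotProduct]; ring)
    (fun r x z ↦ by
      have : star (eisVec (r • x)) = (r : ℂ) • star (eisVec x) := by
        funext i; simp
      rw [this, smul_dotProduct, smul_eq_mul, Complex.re_ofReal_mul, smul_eq_mul]; ring)
    (fun x y z ↦ by simp [mulVec_add, dotProduct_add]; ring)
    (fun r x z ↦ by
      have : eisVec (r • z) = (r : ℂ) • eisVec z := by
        funext i; simp
      rw [this, mulVec_smul, dotProduct_smul, smul_eq_mul, Complex.re_ofReal_mul, smul_eq_mul]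
      ring)

theorem traceForm_apply {n : ℕ} (H : Matrix (Fin n) (Fin n) ℂ) (y z : Fin (n * 2) → ℝ) :
    traceForm H y z = 2 / √3 * (star (eisVec y) ⬝ᵥ H *ᵥ eisVec z).re := rfl

theorem star_dotProduct_mulVec_symm {n : ℕ} {H : Matrix (Fin n) (Fin n) ℂ} (hH : H.IsHermitian)
    (x y : Fin n → ℂ) : star x ⬝ᵥ H *ᵥ y = star (star y ⬝ᵥ H *ᵥ x) := by
  rw [← star_dotProduct_star, star_star, star_mulVec, hH.eq, dotProduct_comm,
    ← dotProduct_mulVec, dotProduct_comm]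

theorem traceForm_symm {n : ℕ} {H : Matrix (Fin n) (Fin n) ℂ} (hH : H.IsHermitian)
    (x y : Fin (n * 2) → ℝ) : traceForm H x y = traceForm H y x := by
  rw [traceForm_apply, traceForm_apply, star_dotProduct_mulVec_symm hH]
  simp

theorem traceForm_pos {n : ℕ} {H : Matrix (Fin n) (Fin n) ℂ} (hH : H.PosDef)
    (x : Fin (n * 2) → ℝ) (hx : x ≠ 0) : 0 < traceForm H x x := by
  have h1 : eisVec x ≠ 0 := fun h ↦ hx (eisVec_injective (by rw [h, map_zero]))
  have h2 := hH.dotProduct_mulVec_pos h1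
  rw [traceForm_apply]
  have := (Complex.lt_def.mp h2).1
  simp only [Complex.zero_re] at this
  positivity

theorem det_mem_eisenstein {n : ℕ} {M : Matrix (Fin n) (Fin n) ℂ} (hM : EntriesIn M) :
    M.det ∈ 𝓞 := by
  rw [det_apply]
  refine sum_mem fun σ _ ↦ ?_
  rw [Units.smul_def]
  exact zsmul_mem (prod_mem fun i _ ↦ hM _ _) _

theorem entriesIn_adjugate {n : ℕ} {M : Matrix (Fin n) (Fin n) ℂ} (hM : EntriesIn M) :
    EntriesIn M.adjugate := by
  intro i j
  rw [adjugate_apply]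
  refine det_mem_eisenstein fun k l ↦ ?_
  rw [updateRow_apply]
  split_ifs with h
  · rw [Pi.single_apply]; split_ifs <;> [exact one_mem _; exact zero_mem _]
  · exact hM k l

theorem EntriesIn.mulVec {n : ℕ} {M : Matrix (Fin n) (Fin n) ℂ} (hM : EntriesIn M)
    {x : Fin n → ℂ} (hx : IsLatVec x) : IsLatVec (M *ᵥ x) := fun i ↦
  show ∑ j, M i j * x j ∈ 𝓞 from sum_mem fun j _ ↦ mul_mem (hM i j) (hx j)

/-- Multiplication by a unimodular Gram matrix as a bijection of `𝓞ⁿ`. -/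
def mulVecEquiv {n : ℕ} {H : Matrix (Fin n) (Fin n) ℂ} (hH : IsUnimodular H) :
    {x : Fin n → ℂ // IsLatVec x} ≃ {x : Fin n → ℂ // IsLatVec x} where
  toFun x := ⟨H *ᵥ x, hH.1.1.mulVec x.2⟩
  invFun x := ⟨H.adjugate *ᵥ x, (entriesIn_adjugate hH.1.1).mulVec x.2⟩
  left_inv x := Subtype.ext (by simp [mulVec_mulVec, adjugate_mul, hH.2])
  right_inv x := Subtype.ext (by simp [mulVec_mulVec, mul_adjugate, hH.2])

theorem eisVec_single_zero {n : ℕ} (i : Fin n) :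
    eisVec (Pi.single (finProdFinEquiv (i, 0)) 1) = Pi.single i 1 := by
  funext j
  rw [eisVec_apply, Pi.single_apply, Pi.single_apply, Pi.single_apply]
  simp only [finProdFinEquiv.injective.eq_iff, Prod.mk.injEq]
  split_ifs <;> simp_all

theorem eisVec_single_one {n : ℕ} (i : Fin n) :
    eisVec (Pi.single (finProdFinEquiv (i, 1)) 1) = Pi.single i ω := by
  funext j
  rw [eisVec_apply, Pi.single_apply, Pi.single_apply, Pi.single_apply]
  simp only [finProdFinEquiv.injective.eq_iff, Prod.mk.injEq]
  split_ifs <;> simp_all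

/-- The dual lattice vector attached to `x ∈ 𝓞ⁿ`, in integral coordinates. -/
def dualCoordEquiv {n : ℕ} {H : Matrix (Fin n) (Fin n) ℂ} (hH : IsUnimodular H) :
    {x : Fin n → ℂ // IsLatVec x} ≃ (Fin (n * 2) → ℤ) :=
  (mulVecEquiv hH).trans ((latVecEquiv n).symm.trans (swapPairs n))

theorem star_single_dotProduct {n : ℕ} (i : Fin n) (a : ℂ) (v : Fin n → ℂ) :
    star (Pi.single i a) ⬝ᵥ v = star a * v i := by
  rw [← Pi.single_star, single_dotProduct]

theorem castVec_dualCoordEquiv {n : ℕ} {H : Matrix (Fin n) (Fin n) ℂ} (hH : IsUnimodular H)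
    (x : {x : Fin n → ℂ // IsLatVec x}) {y : Fin (n * 2) → ℝ}
    (hy : eisVec y = -I • (x : Fin n → ℂ)) :
    castVec (dualCoordEquiv hH x) = fun j ↦ traceForm H (Pi.single j 1) y := by
  set k := (latVecEquiv n).symm (mulVecEquiv hH x) with hk
  have hkx : eisVec (castVec k) = H *ᵥ (x : Fin n → ℂ) := by
    rw [← latVecEquiv_apply, hk, Equiv.apply_symm_apply]; rfl
  have h3 : √3 ≠ 0 := by positivity
  have h33 : √3 * √3 = 3 := Real.mul_self_sqrt (by norm_num)
  have hz : ∀ i, (H *ᵥ (x : Fin n → ℂ)) i =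
      ((k (finProdFinEquiv (i, 0)) : ℝ) : ℂ) + ((k (finProdFinEquiv (i, 1)) : ℝ) : ℂ) * ω := by
    intro i; rw [← hkx]; rfl
  have hdk : dualCoordEquiv hH x = swapPairs n k := rfl
  refine fin_mul_two_ext (fun i ↦ ?_) (fun i ↦ ?_)
  · rw [traceForm_apply, eisVec_single_zero, hy, mulVec_smul, star_single_dotProduct, hdk]
    simp only [castVec, swapPairs, Equiv.coe_fn_mk, interleave_zero, star_one, one_mul,
      Pi.smul_apply, smul_eq_mul, hz]
    simp [omega_im]
    field_simp
  · rw [traceForm_apply, eisVec_single_one, hy, mulVec_smul, star_single_dotProduct, hdk]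
    simp only [castVec, swapPairs, Equiv.coe_fn_mk, interleave_one, star_omega,
      Pi.smul_apply, smul_eq_mul, hz]
    simp [omega_im, omega_re]
    field_simp
    nlinarith

/-- The theta series of a hermitian lattice on the imaginary axis. -/
def thetaReal {n : ℕ} (H : Matrix (Fin n) (Fin n) ℂ) (t : ℝ) : ℝ :=
  ∑' x : {x : Fin n → ℂ // IsLatVec x}, Real.exp (-(π * t) * (2 / √3 * (latNorm H x).re))

theorem summable_thetaReal {n : ℕ} {H : Matrix (Fin n) (Fin n) ℂ} (hH : IsUnimodular H) {t : ℝ}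
    (ht : 0 < t) : Summable (fun x : {x : Fin n → ℂ // IsLatVec x} ↦
      Real.exp (-(π * t) * (2 / √3 * (latNorm H x).re))) := by
  obtain ⟨Q', hD, -⟩ := exists_dualForms (traceForm H) (traceForm_symm hH.1.2.1)
    (traceForm_pos hH.1.2.2)
  obtain ⟨M, hM⟩ := hD.uniformlyGaussSummable.1 (π * t) (by positivity)
  have := (hM 0).1
  simp only [add_zero] at this
  exact (latVecEquiv n).summable_iff.mp this

theorem thetaReal_inv {n : ℕ} {H : Matrix (Fin n) (Fin n) ℂ} (hH : IsUnimodular H) {t : ℝ}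
    (ht : 0 < t) : thetaReal H t = (1 / t) ^ n * thetaReal H t⁻¹ := by
  obtain ⟨Q', hD, hdual⟩ := exists_dualForms (traceForm H) (traceForm_symm hH.1.2.1)
    (traceForm_pos hH.1.2.2)
  obtain ⟨C, hC, h⟩ := hD.tsum_gauss
  have key : ∀ t : ℝ, 0 < t → thetaReal H t = C * (1 / t) ^ n * thetaReal H t⁻¹ := by
    intro t ht
    have h1 := h t ht 0 0
    simp only [add_zero, zero_dotProduct, dotProduct_zero, Complex.ofReal_zero, mul_zero,
      sub_zero, ← Complex.ofReal_exp] at h1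
    rw [← Complex.ofReal_tsum, ← Complex.ofReal_tsum, ← Complex.ofReal_mul,
      Complex.ofReal_inj] at h1
    have hpow : (1 / √t) ^ (n * 2) = (1 / t) ^ n := by
      rw [mul_comm, pow_mul, div_pow, Real.sq_sqrt ht.le, one_pow]
    have hL : thetaReal H t =
        ∑' k : Fin (n * 2) → ℤ, Real.exp (-(π * t) * traceForm H (castVec k) (castVec k)) := by
      rw [thetaReal, ← (latVecEquiv n).tsum_eq]
      rfl
    have hR : thetaReal H t⁻¹ =
        ∑' k : Fin (n * 2) → ℤ, Real.exp (-(π * t⁻¹) * Q' (castVec k)) := by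
      rw [thetaReal, ← (dualCoordEquiv hH).tsum_eq]
      refine tsum_congr fun x ↦ ?_
      obtain ⟨y, hy⟩ := eisVec_surjective (-I • (x : Fin n → ℂ))
      rw [castVec_dualCoordEquiv hH x hy, hdual, traceForm_apply, hy, latNorm]
      congr 4
      rw [mulVec_smul, star_smul, smul_dotProduct, dotProduct_smul, smul_smul]
      simp
    rw [hL, h1, hpow, hR]
  have h1 := key 1 one_pos
  have hpos : 0 < thetaReal H 1 := by
    have hs := summable_thetaReal hH one_pos
    exact hs.tsum_pos (fun x ↦ (Real.exp_pos _).le) ⟨0, fun i ↦ zero_mem 𝓞⟩ (Real.exp_pos _)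
  have hC1 : C = 1 := by
    simp only [inv_one, div_one, one_pow, mul_one] at h1
    nlinarith
  rw [key t ht, hC1, one_mul]

/-- The norm of a lattice vector as a natural number. -/
def latNormNat {n : ℕ} (H : Matrix (Fin n) (Fin n) ℂ) (x : Fin n → ℂ) : ℕ := ⌊(latNorm H x).re⌋₊

theorem latNorm_mem {n : ℕ} {H : Matrix (Fin n) (Fin n) ℂ} (hH : EntriesIn H) {x : Fin n → ℂ}
    (hx : IsLatVec x) : latNorm H x ∈ 𝓞 :=
  show ∑ i, star x i * (H *ᵥ x) i ∈ 𝓞 from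
    sum_mem fun i _ ↦ mul_mem (star_mem_eisenstein (hx i)) (hH.mulVec hx i)

theorem latNorm_eq_latNormNat {n : ℕ} {H : Matrix (Fin n) (Fin n) ℂ} (hH : IsHermLattice H)
    {x : Fin n → ℂ} (hx : IsLatVec x) : latNorm H x = latNormNat H x := by
  have h0 := Complex.le_def.mp (hH.2.2.posSemidef.dotProduct_mulVec_nonneg x)
  obtain ⟨m, hm⟩ := exists_intCast_of_mem_eisenstein (latNorm_mem hH.1 hx) h0.2.symm
  have hm0 : 0 ≤ m := by
    have h1 : (0 : ℝ) ≤ (latNorm H x).re := h0.1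
    rw [hm] at h1
    exact_mod_cast h1
  lift m to ℕ using hm0
  rw [latNormNat, hm]
  simp

/-- The number of lattice vectors of norm `m`. -/
def reprCount {n : ℕ} (H : Matrix (Fin n) (Fin n) ℂ) (m : ℕ) : ℕ :=
  Nat.card {x : Fin n → ℂ // IsLatVec x ∧ latNorm H x = m}

theorem card_fiber_latNormNat {n : ℕ} {H : Matrix (Fin n) (Fin n) ℂ} (hH : IsHermLattice H)
    (m : ℕ) :
    Nat.card {x : {x : Fin n → ℂ // IsLatVec x} // latNormNat H x = m} = reprCount H m := by
  refine Nat.card_congr ((Equiv.subtypeSubtypeEquivSubtypeInter _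
    (fun x ↦ latNormNat H x = m)).trans (Equiv.subtypeEquivRight fun x ↦ ?_))
  refine and_congr_right fun hx ↦ ?_
  rw [latNorm_eq_latNormNat hH hx, Nat.cast_inj]

theorem exp_eq_pow_latNormNat {n : ℕ} {H : Matrix (Fin n) (Fin n) ℂ} (hH : IsHermLattice H)
    (x : {x : Fin n → ℂ // IsLatVec x}) (t : ℝ) :
    Real.exp (-(π * t) * (2 / √3 * (latNorm H x).re)) =
      Real.exp (-(π * t * (2 / √3))) ^ latNormNat H x := by
  rw [latNorm_eq_latNormNat hH x.2, ← Real.exp_nat_mul, Complex.natCast_re]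
  congr 1
  ring

theorem finite_fiber_latNormNat {n : ℕ} {H : Matrix (Fin n) (Fin n) ℂ} (hH : IsUnimodular H)
    (m : ℕ) : Finite {x : {x : Fin n → ℂ // IsLatVec x} // latNormNat H x = m} := by
  have h := (summable_thetaReal hH one_pos).comp_injective
    (Subtype.val_injective (p := fun x : {x : Fin n → ℂ // IsLatVec x} ↦ latNormNat H x = m))
  have h2 : Summable (fun _ : {x : {x : Fin n → ℂ // IsLatVec x} // latNormNat H x = m} ↦
      Real.exp (-(π * 1 * (2 / √3))) ^ m) := by
    refine h.congr fun x ↦ ?_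
    rw [Function.comp_apply, exp_eq_pow_latNormNat hH.1, x.2]
  exact Finite.of_summable_const (by positivity) h2

theorem hasSum_reprCount {n : ℕ} {H : Matrix (Fin n) (Fin n) ℂ} (hH : IsUnimodular H) {t : ℝ}
    (ht : 0 < t) : HasSum (fun m : ℕ ↦ (reprCount H m : ℝ) * Real.exp (-(π * t * (2 / √3))) ^ m)
      (thetaReal H t) := by
  have h := (summable_thetaReal hH ht).hasSum
  simp_rw [exp_eq_pow_latNormNat hH.1] at h
  have h2 := (Equiv.sigmaFiberEquiv
    (fun x : {x : Fin n → ℂ // IsLatVec x} ↦ latNormNat H x)).hasSum_iff.mpr h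
  have h3 := h2.sigma (g := fun m : ℕ ↦
    (reprCount H m : ℝ) * Real.exp (-(π * t * (2 / √3))) ^ m) (fun m ↦ by
      have := finite_fiber_latNormNat hH m
      have := Fintype.ofFinite {x : {x : Fin n → ℂ // IsLatVec x} // latNormNat H x = m}
      convert hasSum_fintype _ using 1
      rw [← card_fiber_latNormNat hH.1, Nat.card_eq_fintype_card, ← nsmul_eq_mul, Fintype.card,
        ← Finset.sum_const]
      refine Finset.sum_congr rfl fun x _ ↦ ?_
      simp [Equiv.sigmaFiberEquiv, x.2])
  rw [thetaReal]
  simp_rw [exp_eq_pow_latNormNat hH.1]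
  exact h3

theorem summable_reprCount {n : ℕ} {H : Matrix (Fin n) (Fin n) ℂ} (hH : IsUnimodular H) {q : ℂ}
    (hq : ‖q‖ < 1) : Summable (fun m : ℕ ↦ (reprCount H m : ℂ) * q ^ m) := by
  obtain ⟨ρ, hqρ, hρ⟩ := exists_between hq
  have hρ0 : 0 < ρ := (norm_nonneg q).trans_lt hqρ
  have hlog : 0 < -Real.log ρ := neg_pos.mpr (Real.log_neg hρ0 hρ)
  have h := (hasSum_reprCount hH (t := -Real.log ρ / (π * (2 / √3))) (by positivity)).summable
  have hexp : Real.exp (-(π * (-Real.log ρ / (π * (2 / √3))) * (2 / √3))) = ρ := by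
    rw [← Real.exp_log hρ0]
    congr 1
    rw [Real.exp_log hρ0]
    field_simp
  rw [hexp] at h
  refine Summable.of_norm_bounded h fun m ↦ ?_
  rw [norm_mul, norm_pow, Complex.norm_natCast]
  gcongr

theorem reprCount_zero {n : ℕ} {H : Matrix (Fin n) (Fin n) ℂ} (hH : IsHermLattice H) :
    reprCount H 0 = 1 := by
  rw [reprCount, Nat.card_eq_one_iff_unique]
  refine ⟨⟨fun x y ↦ Subtype.ext ?_⟩, ⟨0, fun i ↦ zero_mem 𝓞, by simp [latNorm]⟩⟩
  have key : ∀ z : {x : Fin n → ℂ // IsLatVec x ∧ latNorm H x = (0 : ℕ)}, (z : Fin n → ℂ) = 0 := by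
    intro z
    by_contra hz
    have h := hH.2.2.dotProduct_mulVec_pos hz
    have h2 := z.2.2
    rw [latNorm] at h2
    rw [h2] at h
    simp at h
  rw [key x, key y]

open Metric in
theorem differentiableOn_tsum_powerSeries {a : ℕ → ℂ}
    (ha : ∀ q ∈ ball (0 : ℂ) 1, Summable (fun n ↦ a n * q ^ n)) :
    DifferentiableOn ℂ (fun q ↦ ∑' n, a n * q ^ n) (ball 0 1) := by
  intro q hq
  rw [mem_ball_zero_iff] at hq
  obtain ⟨ρ, hqρ, hρ⟩ := exists_between hq
  have hρ0 : 0 ≤ ρ := (norm_nonneg q).trans hqρ.le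
  have hs := (ha (ρ : ℂ) (by simpa [abs_of_nonneg hρ0] using hρ)).norm
  have hd : DifferentiableOn ℂ (fun q ↦ ∑' n, a n * q ^ n) (ball 0 ρ) := by
    refine differentiableOn_tsum_of_summable_norm hs (fun n ↦ by fun_prop) isOpen_ball
      fun n w hw ↦ ?_
    rw [mem_ball_zero_iff] at hw
    rw [norm_mul, norm_mul, norm_pow, norm_pow, Complex.norm_real, Real.norm_of_nonneg hρ0]
    gcongr
  exact (hd.differentiableAt (isOpen_ball.mem_nhds (by simpa using hqρ))).differentiableWithinAt

/-- `f` is holomorphic on the unit disc with Taylor expansion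
`c₀ + c₁ q + c₂ q² + c₃ q³ + O(q⁴)`. -/
def HasJet (f : ℂ → ℂ) (c₀ c₁ c₂ c₃ : ℂ) : Prop :=
  ∃ R : ℂ → ℂ, DifferentiableOn ℂ R (Metric.ball 0 1) ∧
    ∀ q ∈ Metric.ball (0 : ℂ) 1, f q = c₀ + c₁ * q + c₂ * q ^ 2 + c₃ * q ^ 3 + q ^ 4 * R q

namespace HasJet

theorem differentiableOn {f : ℂ → ℂ} {c₀ c₁ c₂ c₃ : ℂ} (h : HasJet f c₀ c₁ c₂ c₃) :
    DifferentiableOn ℂ f (Metric.ball 0 1) := by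
  obtain ⟨R, hR, h⟩ := h
  refine DifferentiableOn.congr ?_ h
  fun_prop

theorem of_powerSeries {a : ℕ → ℂ}
    (ha : ∀ q ∈ Metric.ball (0 : ℂ) 1, Summable (fun n ↦ a n * q ^ n)) :
    HasJet (fun q ↦ ∑' n, a n * q ^ n) (a 0) (a 1) (a 2) (a 3) := by
  refine ⟨fun q ↦ ∑' n, a (n + 4) * q ^ n, differentiableOn_tsum_powerSeries fun q hq ↦ ?_,
    fun q hq ↦ ?_⟩
  · rcases eq_or_ne q 0 with rfl | h0
    · exact summable_of_hasFiniteSupport ((Set.finite_singleton 0).subset fun n hn ↦ by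
        by_contra h
        exact hn (by simp [show n ≠ 0 from h]))
    · have h := ((summable_nat_add_iff 4).mpr (ha q hq)).mul_right (q ^ 4)⁻¹
      refine h.congr fun n ↦ ?_
      rw [pow_add]
      field_simp
  · dsimp only
    rw [← (ha q hq).sum_add_tsum_nat_add 4, ← tsum_mul_left]
    simp only [Finset.sum_range_succ, Finset.sum_range_zero]
    congr 1
    · ring
    · exact tsum_congr fun n ↦ by ring

theorem add {f g : ℂ → ℂ} {c₀ c₁ c₂ c₃ d₀ d₁ d₂ d₃ : ℂ} (hf : HasJet f c₀ c₁ c₂ c₃)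
    (hg : HasJet g d₀ d₁ d₂ d₃) :
    HasJet (fun q ↦ f q + g q) (c₀ + d₀) (c₁ + d₁) (c₂ + d₂) (c₃ + d₃) := by
  obtain ⟨R, hR, hf⟩ := hf
  obtain ⟨S, hS, hg⟩ := hg
  exact ⟨fun q ↦ R q + S q, hR.add hS, fun q hq ↦ by dsimp only; rw [hf q hq, hg q hq]; ring⟩

theorem const_mul {f : ℂ → ℂ} {c₀ c₁ c₂ c₃ : ℂ} (a : ℂ) (hf : HasJet f c₀ c₁ c₂ c₃) :
    HasJet (fun q ↦ a * f q) (a * c₀) (a * c₁) (a * c₂) (a * c₃) := by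
  obtain ⟨R, hR, hf⟩ := hf
  exact ⟨fun q ↦ a * R q, hR.const_mul a, fun q hq ↦ by dsimp only; rw [hf q hq]; ring⟩

theorem mul {f g : ℂ → ℂ} {c₀ c₁ c₂ c₃ d₀ d₁ d₂ d₃ : ℂ} (hf : HasJet f c₀ c₁ c₂ c₃)
    (hg : HasJet g d₀ d₁ d₂ d₃) :
    HasJet (fun q ↦ f q * g q) (c₀ * d₀) (c₀ * d₁ + c₁ * d₀) (c₀ * d₂ + c₁ * d₁ + c₂ * d₀)
      (c₀ * d₃ + c₁ * d₂ + c₂ * d₁ + c₃ * d₀) := by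
  have hg' := hg.differentiableOn
  obtain ⟨R, hR, hf⟩ := hf
  obtain ⟨S, hS, hg⟩ := hg
  refine ⟨fun q ↦ R q * g q + (c₀ + c₁ * q + c₂ * q ^ 2 + c₃ * q ^ 3) * S q +
    (c₁ * d₃ + c₂ * d₂ + c₃ * d₁) + (c₂ * d₃ + c₃ * d₂) * q + c₃ * d₃ * q ^ 2, ?_,
    fun q hq ↦ ?_⟩
  · fun_prop
  · dsimp only; rw [hf q hq, hg q hq]; ring

theorem comp_cube {f : ℂ → ℂ} {c₀ c₁ c₂ c₃ : ℂ} (hf : HasJet f c₀ c₁ c₂ c₃) :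
    HasJet (fun q ↦ f (q ^ 3)) c₀ 0 0 c₁ := by
  obtain ⟨R, hR, hf⟩ := hf
  have hmaps : Set.MapsTo (fun q : ℂ ↦ q ^ 3) (Metric.ball 0 1) (Metric.ball 0 1) := by
    intro q hq
    rw [mem_ball_zero_iff] at hq ⊢
    rw [norm_pow]
    exact pow_lt_one₀ (norm_nonneg q) hq (by norm_num)
  refine ⟨fun q ↦ c₂ * q ^ 2 + c₃ * q ^ 5 + q ^ 8 * R (q ^ 3), ?_, fun q hq ↦ ?_⟩
  · have h : DifferentiableOn ℂ (fun q ↦ R (q ^ 3)) (Metric.ball 0 1) :=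
      hR.comp (by fun_prop) hmaps
    fun_prop
  · dsimp only; rw [hf _ (hmaps hq)]; ring

end HasJet

/-- The nome `exp (2πiz)`. -/
def nome (z : ℂ) : ℂ := cexp (2 * π * I * z)

theorem norm_nome (z : ℂ) : ‖nome z‖ = Real.exp (-(2 * π * z.im)) := by
  rw [nome, Complex.norm_exp]
  congr 1
  simp

theorem nome_mem_ball {z : ℂ} (hz : 0 < z.im) : nome z ∈ Metric.ball (0 : ℂ) 1 := by
  rw [mem_ball_zero_iff, norm_nome, Real.exp_lt_one_iff]
  have := Real.pi_pos
  nlinarith [mul_pos this hz]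

theorem nome_three_mul (z : ℂ) : nome (3 * z) = nome z ^ 3 := by
  rw [nome, nome, ← Complex.exp_nat_mul]; congr 1; push_cast; ring

theorem differentiable_nome : Differentiable ℂ nome := by
  unfold nome; fun_prop

theorem im_neg_one_div_three_mul (z : ℂ) :
    (-1 / (3 * z)).im = z.im / (3 * Complex.normSq z) := by
  rw [Complex.div_im]
  simp
  field_simp

theorem im_neg_one_div_three_mul_pos {z : ℂ} (hz : 0 < z.im) : 0 < (-1 / (3 * z)).im := by
  rw [im_neg_one_div_three_mul]
  have : 0 < Complex.normSq z := Complex.normSq_pos.mpr fun h ↦ by simp [h] at hz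
  positivity

/-- The function `z ↦ f (exp (2πiz))` on the upper half plane transforms like a modular form of
weight 14 under the Fricke involution of level 3, with eigenvalue `-1`. -/
def IsFricke (f : ℂ → ℂ) : Prop :=
  ∀ z : ℂ, 0 < z.im → f (nome (-1 / (3 * z))) = -3 ^ 7 * z ^ 14 * f (nome z)

theorem IsFricke.add {f g : ℂ → ℂ} (hf : IsFricke f) (hg : IsFricke g) :
    IsFricke (fun q ↦ f q + g q) := fun z hz ↦ by
  dsimp only; rw [hf z hz, hg z hz]; ring

theorem IsFricke.const_mul {f : ℂ → ℂ} (a : ℂ) (hf : IsFricke f) :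
    IsFricke (fun q ↦ a * f q) := fun z hz ↦ by
  dsimp only; rw [hf z hz]; ring

theorem isFricke_of_imaginary_axis {f : ℂ → ℂ} (hf : DifferentiableOn ℂ f (Metric.ball 0 1))
    (h : ∀ y : ℝ, 0 < y →
      f (nome (-1 / (3 * (y * I)))) = -3 ^ 7 * (y * I) ^ 14 * f (nome (y * I))) :
    IsFricke f := by
  have ho : IsOpen {z : ℂ | 0 < z.im} := isOpen_lt continuous_const Complex.continuous_im
  have hA : AnalyticOnNhd ℂ (fun z ↦ f (nome (-1 / (3 * z)))) {z : ℂ | 0 < z.im} := by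
    refine DifferentiableOn.analyticOnNhd ?_ ho
    refine hf.comp (differentiable_nome.comp_differentiableOn ?_)
      fun z hz ↦ nome_mem_ball (im_neg_one_div_three_mul_pos hz)
    refine DifferentiableOn.div (by fun_prop) (by fun_prop) fun z hz h0 ↦ ?_
    have : z = 0 := by simpa using h0
    simp [this] at hz
  have hB : AnalyticOnNhd ℂ (fun z ↦ -3 ^ 7 * z ^ 14 * f (nome z)) {z : ℂ | 0 < z.im} := by
    refine DifferentiableOn.analyticOnNhd ?_ ho
    have := hf.comp differentiable_nome.differentiableOn
      (s := {z : ℂ | 0 < z.im}) fun z hz ↦ nome_mem_ball hz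
    exact DifferentiableOn.mul (by fun_prop) this
  have hpre : IsPreconnected {z : ℂ | 0 < z.im} := (convex_halfSpace_im_gt 0).isPreconnected
  have hfreq : ∃ᶠ z in nhdsWithin I {I}ᶜ,
      f (nome (-1 / (3 * z))) = -3 ^ 7 * z ^ 14 * f (nome z) := by
    have ht : Filter.Tendsto (fun y : ℝ ↦ (y : ℂ) * I) (nhdsWithin 1 (Set.Ioi 1))
        (nhdsWithin I {I}ᶜ) := by
      refine tendsto_nhdsWithin_iff.mpr ⟨?_, ?_⟩
      · have hc : Continuous (fun y : ℝ ↦ (y : ℂ) * I) := by fun_prop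
        have := hc.tendsto 1
        simp only [Complex.ofReal_one, one_mul] at this
        exact this.mono_left nhdsWithin_le_nhds
      · filter_upwards [self_mem_nhdsWithin] with y hy h0
        have h1 := congrArg Complex.im (Set.mem_singleton_iff.mp h0)
        simp at h1
        exact (ne_of_gt (Set.mem_Ioi.mp hy)) h1
    refine ht.frequently (Filter.Eventually.frequently ?_)
    filter_upwards [self_mem_nhdsWithin] with y hy
    exact h y (one_pos.trans (Set.mem_Ioi.mp hy))
  intro z hz
  exact hA.eqOn_of_preconnected_of_frequently_eq hB hpre (z₀ := I) (by simp) hfreq hz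

/-- The theta series of a hermitian lattice as a function of the nome. -/
def thetaSeries {n : ℕ} (H : Matrix (Fin n) (Fin n) ℂ) (q : ℂ) : ℂ :=
  ∑' m : ℕ, (reprCount H m : ℂ) * q ^ m

theorem hasJet_thetaSeries {n : ℕ} {H : Matrix (Fin n) (Fin n) ℂ} (hH : IsUnimodular H) :
    HasJet (thetaSeries H) (reprCount H 0) (reprCount H 1) (reprCount H 2) (reprCount H 3) :=
  HasJet.of_powerSeries (a := fun m ↦ (reprCount H m : ℂ)) fun _ hq ↦
    summable_reprCount hH (mem_ball_zero_iff.mp hq)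

theorem thetaSeries_nome_mul_I {n : ℕ} {H : Matrix (Fin n) (Fin n) ℂ} (hH : IsUnimodular H)
    {y : ℝ} (hy : 0 < y) : thetaSeries H (nome (y * I)) = thetaReal H (√3 * y) := by
  have hn : nome (y * I) = (Real.exp (-(π * (√3 * y) * (2 / √3))) : ℝ) := by
    rw [nome, Complex.ofReal_exp]
    congr 1
    have : π * (√3 * y) * (2 / √3) = 2 * π * y := by field_simp
    rw [this]
    push_cast
    linear_combination (2 * π * y : ℂ) * I_sq
  rw [thetaSeries, hn, ← (hasSum_reprCount hH (t := √3 * y) (by positivity)).tsum_eq,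
    Complex.ofReal_tsum]
  push_cast
  rfl

theorem isFricke_thetaSeries {H : Matrix (Fin 14) (Fin 14) ℂ} (hH : IsUnimodular H) :
    IsFricke (thetaSeries H) := by
  refine isFricke_of_imaginary_axis (hasJet_thetaSeries hH).differentiableOn fun y hy ↦ ?_
  have h3 : √3 * √3 = 3 := Real.mul_self_sqrt (by norm_num)
  have hz : -1 / (3 * ((y : ℂ) * I)) = ((1 / (3 * y) : ℝ) : ℂ) * I := by
    have hy' : (y : ℂ) ≠ 0 := by exact_mod_cast hy.ne'
    push_cast
    field_simp
    rw [I_sq]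
  have hinv : √3 * (1 / (3 * y)) = (√3 * y)⁻¹ := by
    field_simp
    nlinarith
  rw [hz, thetaSeries_nome_mul_I hH (by positivity), thetaSeries_nome_mul_I hH hy, hinv,
    thetaReal_inv hH (t := √3 * y) (by positivity)]
  have hpow : √3 ^ 14 = 3 ^ 7 := by
    rw [show 14 = 2 * 7 from rfl, pow_mul, Real.sq_sqrt (by norm_num)]
  have hI : I ^ 14 = -1 := by
    rw [show 14 = 2 * 7 from rfl, pow_mul, I_sq]; norm_num
  rw [mul_pow, hI, div_pow, mul_pow, hpow]
  have hy' : (y : ℂ) ≠ 0 := by exact_mod_cast hy.ne'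
  push_cast
  field_simp

open UpperHalfPlane ModularForm EisensteinSeries in
theorem exists_eisenstein_hasJet {k : ℕ} (hk : 3 ≤ k) (hk2 : Even k) {b : ℚ}
    (hb : -(2 * k / bernoulli k) = b) :
    ∃ e : ℂ → ℂ, HasJet e 1 b (b * (1 + 2 ^ (k - 1))) (b * (1 + 3 ^ (k - 1))) ∧
      ∀ z : ℂ, 0 < z.im → e (nome (-1 / z)) = z ^ k * e (nome z) := by
  have hΓ : (1 : ℝ) ∈ (MonoidHom.range (Matrix.SpecialLinearGroup.mapGL ℝ :
      Matrix.SpecialLinearGroup (Fin 2) ℤ →* GL (Fin 2) ℝ)).strictPeriods := by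
    simp
  set a : ℕ → ℂ := fun n ↦ (qExpansion 1 (E hk)).coeff n with ha
  have hsum : ∀ q ∈ Metric.ball (0 : ℂ) 1, Summable fun n ↦ a n * q ^ n := fun q hq ↦ by
    have := hasSum_qExpansion_of_norm_lt one_pos
      (SlashInvariantFormClass.periodic_comp_ofComplex (E hk) hΓ)
      (ModularFormClass.holo (E hk)) (ModularFormClass.bdd_at_infty (E hk))
      (mem_ball_zero_iff.mp hq)
    simpa using this.summable
  have hval : ∀ z : ℍ, ∑' n, a n * nome z ^ n = E hk z := fun z ↦ by
    rw [← (ModularForm.hasSum_qExpansion (f := E hk) one_pos hΓ z).tsum_eq]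
    simp [ha, nome, Function.Periodic.qParam]
  refine ⟨fun q ↦ ∑' n, a n * q ^ n, ?_, fun z hz ↦ ?_⟩
  · have hb' : -(2 * k / bernoulli k : ℂ) = b := by rw [← hb]; push_cast; rfl
    have h := HasJet.of_powerSeries hsum
    have hcoeff (n : ℕ) :
        a n = if n = 0 then 1 else (b : ℂ) * ArithmeticFunction.sigma (k - 1) n := by
      rw [ha, ← hb']
      exact E_qExpansion_coeff hk hk2 n
    rw [hcoeff 0, hcoeff 1, hcoeff 2, hcoeff 3] at h
    have h2 : ArithmeticFunction.sigma (k - 1) 2 = 1 + 2 ^ (k - 1) := by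
      simp [ArithmeticFunction.sigma_apply, Nat.Prime.divisors Nat.prime_two]
    have h3 : ArithmeticFunction.sigma (k - 1) 3 = 1 + 3 ^ (k - 1) := by
      simp [ArithmeticFunction.sigma_apply, Nat.Prime.divisors Nat.prime_three]
    simpa [h2, h3] using! h
  · have hS := SlashInvariantForm.slash_action_eqn'' (E hk)
      (γ := Matrix.SpecialLinearGroup.mapGL ℝ ModularGroup.S) (MonoidHom.mem_range.mpr ⟨ModularGroup.S, rfl⟩) ⟨z, hz⟩
    have h1 := hval (ModularGroup.S • ⟨z, hz⟩)
    have h2 := hval ⟨z, hz⟩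
    have h3 : ((ModularGroup.S • (⟨z, hz⟩ : ℍ) : ℍ) : ℂ) = -1 / z := by
      rw [modular_S_smul]
      simp [neg_div, inv_neg]
    have hd : denom (Matrix.SpecialLinearGroup.mapGL ℝ ModularGroup.S) (⟨z, hz⟩ : ℍ) = z := by
      exact ModularGroup.denom_S _
    simp only [h3] at h1
    simp only at h2
    simp only [h1, h2]
    rw [hd, zpow_natCast] at hS
    exact hS

/-- `f`, viewed as a function of the nome, transforms with weight `k` under `z ↦ -1 / z`. -/
def IsInversionWeight (f : ℂ → ℂ) (k : ℕ) : Prop :=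
  ∀ z : ℂ, 0 < z.im → f (nome (-1 / z)) = z ^ k * f (nome z)

theorem IsInversionWeight.mul {f g : ℂ → ℂ} {j k : ℕ} (hf : IsInversionWeight f j)
    (hg : IsInversionWeight g k) : IsInversionWeight (fun q ↦ f q * g q) (j + k) := fun z hz ↦ by
  dsimp only
  rw [hf z hz, hg z hz]
  ring

theorem IsInversionWeight.isFricke {f g : ℂ → ℂ} {j k : ℕ} {c : ℂ} (hf : IsInversionWeight f j)
    (hg : IsInversionWeight g k) (hjk : j + k = 14) (hj : 3 ^ j = c * 3 ^ 7)
    (hk : c * 3 ^ k = 3 ^ 7) :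
    IsFricke (fun q ↦ f q * g (q ^ 3) + -c * (g q * f (q ^ 3))) := fun z hz ↦ by
  have hz0 : z ≠ 0 := by rintro rfl; simp at hz
  have h3 : 0 < (3 * z).im := by simpa using hz
  have hinv : 3 * (-1 / (3 * z)) = -1 / z := by field_simp
  dsimp only
  rw [← nome_three_mul, ← nome_three_mul, hinv, hf _ h3, hg _ h3, hf _ hz, hg _ hz, mul_pow,
    mul_pow, hj, ← hjk, pow_add]
  linear_combination (f (nome z) * g (nome (3 * z)) * z ^ j * z ^ k) * (-hk)

theorem exists_isFricke_hasJet (a : ℂ) : ∃ f, IsFricke f ∧ HasJet f 1 0 a 17472 := by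
  obtain ⟨e₄, h₄, w₄⟩ := exists_eisenstein_hasJet (k := 4) (b := 240) (by norm_num) ⟨2, rfl⟩
    (by rw [show bernoulli 4 = -1 / 30 by decide +kernel]; norm_num)
  obtain ⟨e₆, h₆, w₆⟩ := exists_eisenstein_hasJet (k := 6) (b := -504) (by norm_num) ⟨3, rfl⟩
    (by rw [show bernoulli 6 = 1 / 42 by decide +kernel]; norm_num)
  replace w₄ : IsInversionWeight e₄ 4 := w₄
  replace w₆ : IsInversionWeight e₆ 6 := w₆
  have w₀ : IsInversionWeight (fun _ ↦ 1) 0 := fun z _ ↦ by simp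
  have h₀ : HasJet (fun _ ↦ 1) 1 0 0 0 := ⟨0, differentiableOn_const 0, fun q _ ↦ by simp⟩
  have f₁ := ((w₄.mul w₄).mul w₆).isFricke w₀ (c := 3 ^ 7) (by norm_num) (by norm_num) (by norm_num)
  have f₂ := (w₄.mul w₆).isFricke w₄ (c := 27) (by norm_num) (by norm_num) (by norm_num)
  have f₃ := (w₄.mul w₄).isFricke w₆ (c := 3) (by norm_num) (by norm_num) (by norm_num)
  have j₁ := (((h₄.mul h₄).mul h₆).mul h₀).add
    ((h₀.mul ((h₄.mul h₄).mul h₆).comp_cube).const_mul (-3 ^ 7))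
  have j₂ := ((h₄.mul h₆).mul h₄.comp_cube).add ((h₄.mul (h₄.mul h₆).comp_cube).const_mul (-27))
  have j₃ := ((h₄.mul h₄).mul h₆.comp_cube).add ((h₆.mul (h₄.mul h₄).comp_cube).const_mul (-3))
  refine ⟨_, ((f₁.const_mul (-2663 / 5913600 - 17 / 212889600 * a)).add
    (f₂.const_mul (-67 / 140800 + 3 / 563200 * a))).add
    (f₃.const_mul (-869 / 537600 + 349 / 19353600 * a)), ?_⟩
  have j := ((j₁.const_mul (-2663 / 5913600 - 17 / 212889600 * a)).add
    (j₂.const_mul (-67 / 140800 + 3 / 563200 * a))).add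
    (j₃.const_mul (-869 / 537600 + 349 / 19353600 * a))
  convert j using 1 <;> push_cast <;> ring

/-- The Euler product `∏ (1 - q ^ n)` raised to the power 24. -/
def eulerProd (q : ℂ) : ℂ := (∏' n : ℕ, (1 - q ^ (n + 1))) ^ 24

theorem differentiableOn_eulerProd : DifferentiableOn ℂ eulerProd (Metric.ball 0 1) :=
  ModularForm.differentiableOn_tprod_one_sub_pow.pow 24

theorem eulerProd_ne_zero {q : ℂ} (hq : q ∈ Metric.ball (0 : ℂ) 1) : eulerProd q ≠ 0 := by
  have hq1 : ‖q‖ < 1 := mem_ball_zero_iff.mp hq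
  refine pow_ne_zero _ ?_
  simp_rw [sub_eq_add_neg]
  refine tprod_one_add_ne_zero_of_summable (fun n h ↦ ?_) ?_
  · have h1 : q ^ (n + 1) = 1 := by linear_combination -h
    have h2 := congrArg norm h1
    rw [norm_pow, norm_one] at h2
    exact (pow_lt_one₀ (norm_nonneg q) hq1 n.succ_ne_zero).ne h2
  · simp only [norm_neg, norm_pow]
    exact (summable_nat_add_iff 1).mpr (summable_geometric_of_lt_one (norm_nonneg q) hq1)

open UpperHalfPlane in
theorem eulerProd_nome_neg_one_div {z : ℂ} (hz : 0 < z.im) :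
    nome (-1 / z) * eulerProd (nome (-1 / z)) = z ^ 12 * (nome z * eulerProd (nome z)) := by
  have hval : ∀ z : ℍ, ModularForm.discriminant z = nome z * eulerProd (nome z) := fun z ↦ by
    rw [ModularForm.discriminant_eq_q_prod]
    have : Function.Periodic.qParam 1 (z : ℂ) = nome z := by
      simp [nome, Function.Periodic.qParam]
    rw [eulerProd, ← Multipliable.tprod_pow]
    · simp [this, ModularForm.eta_q_eq_pow, nome]
    · exact ModularForm.multipliable_one_sub_pow (mem_ball_zero_iff.mp (nome_mem_ball z.im_pos))
  have hS := SlashInvariantForm.slash_action_eqn'' CuspForm.discriminant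
    (γ := Matrix.SpecialLinearGroup.mapGL ℝ ModularGroup.S)
    (MonoidHom.mem_range.mpr ⟨ModularGroup.S, rfl⟩) ⟨z, hz⟩
  have h1 := hval (ModularGroup.S • ⟨z, hz⟩)
  have h2 := hval ⟨z, hz⟩
  have h3 : ((ModularGroup.S • (⟨z, hz⟩ : ℍ) : ℍ) : ℂ) = -1 / z := by
    rw [modular_S_smul]
    simp [neg_div, inv_neg]
  have hd : denom (Matrix.SpecialLinearGroup.mapGL ℝ ModularGroup.S) (⟨z, hz⟩ : ℍ) = z :=
    ModularGroup.denom_S _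
  rw [h3] at h1
  simp only at h2
  rw [hd] at hS
  rw [← h1, ← h2]
  exact_mod_cast hS

theorem nome_add_intCast (z : ℂ) (n : ℤ) : nome (z + n) = nome z := by
  rw [nome, nome, mul_add, Complex.exp_add, mul_comm (2 * π * I) (n : ℂ),
    Complex.exp_int_mul_two_pi_mul_I, mul_one]

theorem exists_nome_eq {q : ℂ} {y : ℝ} (hq : ‖q‖ = Real.exp (-(2 * π * y))) :
    ∃ z : ℂ, z.im = y ∧ nome z = q := by
  have hq0 : q ≠ 0 := by
    rw [← norm_ne_zero_iff, hq]
    exact (Real.exp_pos _).ne'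
  have hn : nome (Complex.log q / (2 * π * I)) = q := by
    rw [nome, mul_div_cancel₀ _ Complex.two_pi_I_ne_zero, Complex.exp_log hq0]
  refine ⟨_, ?_, hn⟩
  have h := norm_nome (Complex.log q / (2 * π * I))
  rw [hn, hq, Real.exp_eq_exp] at h
  exact (mul_left_cancel₀ Real.two_pi_pos.ne' (neg_injective h)).symm

/-- A bound that is preserved by `z ↦ z + 1` and `z ↦ -1 / (3 z)` and holds near the cusp holds on
the whole upper half-plane. -/
theorem forall_of_fricke_invariant {P : ℂ → Prop} (hT : ∀ z : ℂ, ∀ n : ℤ, P (z + n) → P z)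
    (hW : ∀ z : ℂ, 0 < z.im → P (-1 / (3 * z)) → P z)
    (hP : ∀ z : ℂ, 1 / 5 ≤ z.im → P z) {z : ℂ} (hz : 0 < z.im) : P z := by
  have key : ∀ n : ℕ, ∀ z : ℂ, 0 < z.im → 1 / 5 * (11 / 12 : ℝ) ^ n ≤ z.im → P z := by
    intro n
    induction n with
    | zero => exact fun z _ hz ↦ hP z (by simpa using hz)
    | succ n ih =>
      intro z hz hzn
      by_cases h5 : 1 / 5 ≤ z.im
      · exact hP z h5
      push Not at h5
      refine hT z (-round z.re) ?_
      set w : ℂ := z + ((-round z.re : ℤ) : ℂ) with hw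
      have hwi : w.im = z.im := by simp [hw]
      have hwr : |w.re| ≤ 1 / 2 := by simpa [hw, sub_eq_add_neg] using abs_sub_round z.re
      have hwpos : 0 < w.im := hwi ▸ hz
      refine hW w hwpos (ih _ (im_neg_one_div_three_mul_pos hwpos) ?_)
      rw [im_neg_one_div_three_mul]
      have hre := abs_le.mp hwr
      have hN : 3 * normSq w ≤ 11 / 12 := by
        rw [normSq_apply]
        nlinarith
      have hN0 : 0 < 3 * normSq w := by
        have : 0 < normSq w := normSq_pos.mpr (by rintro h; rw [h] at hwpos; simp at hwpos)
        positivity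
      rw [le_div_iff₀ hN0, hwi]
      rw [pow_succ] at hzn
      calc 1 / 5 * (11 / 12 : ℝ) ^ n * (3 * normSq w) ≤ 1 / 5 * (11 / 12) ^ n * (11 / 12) := by
            gcongr
        _ ≤ z.im := by linarith
  obtain ⟨n, hn⟩ := exists_pow_lt_of_lt_one (y := (11 / 12 : ℝ)) hz (by norm_num)
  exact key n z hz (by nlinarith [pow_pos (show (0 : ℝ) < 11 / 12 by norm_num) n])

theorem eq_zero_of_isFricke_of_hasJet {f : ℂ → ℂ} {c : ℂ} (hf : IsFricke f)
    (hj : HasJet f 0 0 0 c) : c = 0 := by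
  obtain ⟨R, hR, hfR⟩ := hj
  set u : ℂ → ℂ := fun q ↦ c + q * R q with hu
  have hfu : ∀ q ∈ Metric.ball (0 : ℂ) 1, f q = q ^ 3 * u q := fun q hq ↦ by
    rw [hfR q hq, hu]; ring
  have hcube : Set.MapsTo (fun q : ℂ ↦ q ^ 3) (Metric.ball 0 1) (Metric.ball 0 1) := by
    intro q hq
    rw [mem_ball_zero_iff] at hq ⊢
    rw [norm_pow]
    exact pow_lt_one₀ (norm_nonneg q) hq three_ne_zero
  set v : ℂ → ℂ := fun q ↦ eulerProd q * eulerProd (q ^ 3) with hv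
  have hv0 : ∀ q ∈ Metric.ball (0 : ℂ) 1, v q ≠ 0 := fun q hq ↦
    mul_ne_zero (eulerProd_ne_zero hq) (eulerProd_ne_zero (hcube hq))
  set g : ℂ → ℂ := fun q ↦ u q ^ 4 / v q ^ 3 with hg
  have hgd : DifferentiableOn ℂ g (Metric.ball 0 1) := by
    have h1 : DifferentiableOn ℂ u (Metric.ball 0 1) :=
      (differentiableOn_const c).add (differentiableOn_id.mul hR)
    have h2 : DifferentiableOn ℂ v (Metric.ball 0 1) :=
      differentiableOn_eulerProd.mul
        (differentiableOn_eulerProd.comp (differentiable_pow 3).differentiableOn hcube)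
    exact (h1.pow 4).div (h2.pow 3) fun q hq ↦ pow_ne_zero _ (hv0 q hq)
  have hgW : ∀ z : ℂ, 0 < z.im → g (nome z) = 3 ^ 8 * z ^ 16 * g (nome (-1 / (3 * z))) := by
    intro z hz
    have hz0 : z ≠ 0 := by rintro rfl; simp at hz
    have h3 : 0 < (3 * z).im := by simpa using hz
    have hw := im_neg_one_div_three_mul_pos hz
    have hinv : 3 * (-1 / (3 * z)) = -1 / z := by field_simp
    set w := -1 / (3 * z) with hwdef
    have hF := hf z hz
    rw [← hwdef, hfu _ (nome_mem_ball hw), hfu _ (nome_mem_ball hz)] at hF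
    have hD1 := eulerProd_nome_neg_one_div h3
    have hD2 := eulerProd_nome_neg_one_div hz
    rw [← hwdef, nome_three_mul] at hD1
    rw [← hinv, nome_three_mul] at hD2
    have hqz : nome z ≠ 0 := Complex.exp_ne_zero _
    have hqw : nome w ≠ 0 := Complex.exp_ne_zero _
    have hvz := hv0 _ (nome_mem_ball hz)
    have hvw := hv0 _ (nome_mem_ball hw)
    have hV : nome w ^ 4 * v (nome w) = 3 ^ 12 * z ^ 24 * (nome z ^ 4 * v (nome z)) := by
      rw [hv]
      linear_combination (nome w ^ 3 * eulerProd (nome w ^ 3)) * hD1 +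
        (3 * z) ^ 12 * (nome z ^ 3 * eulerProd (nome z ^ 3)) * hD2
    have hU : nome w ^ 12 * u (nome w) ^ 4 = 3 ^ 28 * z ^ 56 * (nome z ^ 12 * u (nome z) ^ 4) := by
      linear_combination congrArg (· ^ 4) hF
    have hV3 : nome w ^ 12 * v (nome w) ^ 3
        = 3 ^ 36 * z ^ 72 * (nome z ^ 12 * v (nome z) ^ 3) := by
      linear_combination congrArg (· ^ 3) hV
    rw [hg]
    dsimp only
    rw [← mul_div_assoc, div_eq_div_iff (pow_ne_zero _ hvz) (pow_ne_zero _ hvw)]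
    refine mul_left_cancel₀ (mul_ne_zero (pow_ne_zero 12 hqw) (pow_ne_zero 12 hqz)) ?_
    linear_combination (nome z ^ 12 * u (nome z) ^ 4) * hV3 -
      3 ^ 8 * z ^ 16 * (nome z ^ 12 * v (nome z) ^ 3) * hU
  obtain ⟨M, hM⟩ := (isCompact_closedBall (0 : ℂ)
    (Real.exp (-(2 * π * (1 / 5))))).exists_bound_of_continuousOn (hgd.continuousOn.mono fun q hq ↦ by
      rw [mem_closedBall_zero_iff] at hq
      rw [mem_ball_zero_iff]
      refine hq.trans_lt (Real.exp_lt_one_iff.mpr ?_)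
      have := Real.pi_pos
      linarith)
  have hM0 : 0 ≤ M := (norm_nonneg _).trans (hM 0 (by simp [Real.exp_nonneg]))
  have hbound : ∀ z : ℂ, 0 < z.im → ‖g (nome z)‖ ≤ M * 5 ^ 8 * z.im ^ 8 := fun z hz ↦ by
    refine forall_of_fricke_invariant (P := fun z ↦ ‖g (nome z)‖ ≤ M * 5 ^ 8 * z.im ^ 8)
      (fun z n h ↦ ?_) (fun z hz h ↦ ?_) (fun z hz ↦ ?_) hz
    · simpa [nome_add_intCast] using h
    · have hN : 0 < normSq z := normSq_pos.mpr (by rintro rfl; simp at hz)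
      rw [hgW z hz, norm_mul, norm_mul, norm_pow, norm_pow]
      rw [im_neg_one_div_three_mul] at h
      have h16 : ‖z‖ ^ 16 = normSq z ^ 8 := by
        rw [normSq_eq_norm_sq, ← pow_mul]
      rw [h16]
      calc ‖(3 : ℂ)‖ ^ 8 * normSq z ^ 8 * ‖g (nome (-1 / (3 * z)))‖
          ≤ 3 ^ 8 * normSq z ^ 8 * (M * 5 ^ 8 * (z.im / (3 * normSq z)) ^ 8) := by
            rw [show ‖(3 : ℂ)‖ = 3 by simp]
            gcongr
        _ = M * 5 ^ 8 * z.im ^ 8 := by field_simp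
    · refine (hM _ ?_).trans ?_
      · rw [mem_closedBall_zero_iff, norm_nome]
        gcongr
      · have : 1 ≤ (5 * z.im) ^ 8 := one_le_pow₀ (by linarith)
        calc M ≤ M * (5 * z.im) ^ 8 := le_mul_of_one_le_right hM0 this
          _ = _ := by ring
  have hg0 : ∀ y : ℝ, 0 < y → ‖g 0‖ ≤ M * 5 ^ 8 * y ^ 8 := by
    intro y hy
    have hr : Real.exp (-(2 * π * y)) < 1 := by
      rw [Real.exp_lt_one_iff]
      have := Real.pi_pos
      simp only [Left.neg_neg_iff]
      positivity
    refine Complex.norm_le_of_forall_mem_frontier_norm_le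
      (U := Metric.ball 0 (Real.exp (-(2 * π * y)))) Metric.isBounded_ball ?_ (fun q hq ↦ ?_)
      (subset_closure (by simp [Real.exp_pos]))
    · refine (hgd.mono ?_).diffContOnCl
      rw [closure_ball _ (Real.exp_pos _).ne']
      exact Metric.closedBall_subset_ball hr
    · rw [frontier_ball _ (Real.exp_pos _).ne', mem_sphere_zero_iff_norm] at hq
      obtain ⟨z, rfl, rfl⟩ := exists_nome_eq hq
      exact hbound z hy
  have hlim : ‖g 0‖ ≤ 0 := by
    have ht : Filter.Tendsto (fun y : ℝ ↦ M * 5 ^ 8 * y ^ 8) (nhdsWithin 0 (Set.Ioi 0))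
        (nhds 0) := by
      have : Continuous fun y : ℝ ↦ M * 5 ^ 8 * y ^ 8 := by fun_prop
      simpa using (this.tendsto 0).mono_left nhdsWithin_le_nhds
    refine ge_of_tendsto ht ?_
    filter_upwards [self_mem_nhdsWithin] with y hy using hg0 y hy
  have h0 : (0 : ℂ) ∈ Metric.ball (0 : ℂ) 1 := by simp
  have h1 : g 0 = 0 := norm_le_zero_iff.mp hlim
  rw [hg] at h1
  have h2 := (div_eq_zero_iff.mp h1).resolve_right (pow_ne_zero _ (hv0 0 h0))
  simpa [hu] using h2

theorem exists_mem_eisenstein_normSq_sub_lt_one (z : ℂ) : ∃ q ∈ 𝓞, normSq (z - q) < 1 := by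
  have h3 : √3 * √3 = 3 := Real.mul_self_sqrt (by norm_num)
  have h30 : √3 ≠ 0 := by positivity
  set b : ℝ := 2 * z.im / √3 with hb
  set a : ℝ := z.re + b / 2 with ha
  have hz : z.im = b * (√3 / 2) := by rw [hb]; field_simp
  refine ⟨round a + round b * ω, mem_eisenstein_iff.mpr ⟨_, _, rfl⟩, ?_⟩
  have h1 := abs_le.mp (abs_sub_round a)
  have h2 := abs_le.mp (abs_sub_round b)
  have hre : (z - (round a + round b * ω)).re = (a - round a) - (b - round b) / 2 := by
    have h := re_add_mul_omega (round a) (round b)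
    simp only [ofReal_intCast] at h
    rw [sub_re, h]
    ring
  have him : (z - (round a + round b * ω)).im = (b - round b) * (√3 / 2) := by
    have h := im_add_mul_omega (round a) (round b)
    simp only [ofReal_intCast] at h
    rw [sub_im, h, hz]
    ring
  rw [normSq_apply, hre, him]
  set s := a - round a
  set t := b - round b
  have hs : s * s ≤ 1 / 4 := by nlinarith
  have ht : t * t ≤ 1 / 4 := by nlinarith
  calc (s - t / 2) * (s - t / 2) + t * (√3 / 2) * (t * (√3 / 2)) = s * s - s * t + t * t := by
        linear_combination (t * t / 4) * h3
    _ < 1 := by nlinarith [sq_nonneg (s + t)]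

theorem exists_natCast_eq_normSq {z : ℂ} (hz : z ∈ 𝓞) : ∃ n : ℕ, normSq z = n := by
  obtain ⟨m, n, rfl⟩ := mem_eisenstein_iff.mp hz
  have h3 : √3 * √3 = 3 := Real.mul_self_sqrt (by norm_num)
  have h : normSq (m + n * ω) = ((m * m - m * n + n * n : ℤ) : ℝ) := by
    have hre := re_add_mul_omega m n
    have him := im_add_mul_omega m n
    simp only [ofReal_intCast] at hre him
    rw [normSq_apply, hre, him]
    push_cast
    linear_combination (n * n / 4 : ℝ) * h3
  have h0 : 0 ≤ m * m - m * n + n * n := by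
    have := normSq_nonneg (m + n * ω : ℂ)
    rw [h] at this
    exact_mod_cast this
  refine ⟨(m * m - m * n + n * n).toNat, ?_⟩
  rw [h]
  exact_mod_cast (Int.toNat_of_nonneg h0).symm

theorem isPrincipalIdealRing_eisenstein : IsPrincipalIdealRing 𝓞 := by
  refine ⟨fun I ↦ ?_⟩
  by_cases hI : I = ⊥
  · exact hI ▸ bot_isPrincipal
  obtain ⟨x₀, hx₀, hx₀'⟩ := Submodule.exists_mem_ne_zero_of_ne_bot hI
  choose N hN using fun z : 𝓞 ↦ exists_natCast_eq_normSq z.2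
  obtain ⟨d, ⟨hdI, hd0⟩, hmin⟩ := exists_minimalFor_of_wellFoundedLT
    (fun z : 𝓞 ↦ z ∈ I ∧ z ≠ 0) N ⟨x₀, hx₀, hx₀'⟩
  refine ⟨d, le_antisymm (fun z hz ↦ ?_) ((Submodule.span_singleton_le_iff_mem _ _).mpr hdI)⟩
  have hdc : (d : ℂ) ≠ 0 := by simpa using hd0
  obtain ⟨q, hq, hlt⟩ := exists_mem_eisenstein_normSq_sub_lt_one ((z : ℂ) / d)
  have hr : z - ⟨q, hq⟩ * d ∈ I := I.sub_mem hz (I.mul_mem_left _ hdI)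
  by_cases hr0 : z - ⟨q, hq⟩ * d = 0
  · exact Submodule.mem_span_singleton.mpr ⟨⟨q, hq⟩, (sub_eq_zero.mp hr0).symm⟩
  exfalso
  have hltd : N (z - ⟨q, hq⟩ * d) < N d := by
    have : (N (z - ⟨q, hq⟩ * d) : ℝ) < N d := by
      rw [← hN, ← hN]
      have he : ((z - ⟨q, hq⟩ * d : 𝓞) : ℂ) = ((z : ℂ) / d - q) * d := by
        push_cast
        field_simp
      rw [he, normSq_mul]
      exact mul_lt_of_lt_one_left (normSq_pos.mpr hdc) hlt
    exact_mod_cast this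
  exact (hmin ⟨hr, hr0⟩ hltd.le).not_gt hltd

/-- A vector on which some linear form takes the value `1` extends to a basis by elements of the
kernel of the form. -/
theorem exists_basis_of_apply_eq_one {A M : Type*} [CommRing A] [IsDomain A]
    [IsPrincipalIdealRing A] [AddCommGroup M] [Module A M] {n : ℕ}
    (b₀ : Module.Basis (Fin (n + 1)) A M) (φ : M →ₗ[A] A) {x : M} (hx : φ x = 1) :
    ∃ b : Module.Basis (Fin (n + 1)) A M, b 0 = x ∧ ∀ i : Fin n, φ (b i.succ) = 0 := by
  obtain ⟨m, c⟩ := Submodule.basisOfPid b₀ (LinearMap.ker φ)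
  let b := Module.Basis.mkFinCons x c
    (fun a v hv h ↦ by simpa [hx, LinearMap.mem_ker.mp hv] using congrArg φ h)
    (fun z ↦ ⟨-φ z, by simp [hx]⟩)
  have hm : m = n := by
    simpa using Fintype.card_congr (b.indexEquiv b₀)
  subst hm
  refine ⟨b, by simp [b], fun i ↦ ?_⟩
  simp [b]

theorem Decomposable.of_norm_one {n : ℕ} {H : Matrix (Fin (n + 2)) (Fin (n + 2)) ℂ}
    (hH : IsHermLattice H) {x : Fin (n + 2) → ℂ} (hx : IsLatVec x) (h1 : latNorm H x = 1) :
    Decomposable H := by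
  have := isPrincipalIdealRing_eisenstein
  have hmem : ∀ v : Fin (n + 2) → 𝓞, star x ⬝ᵥ H *ᵥ (fun i ↦ (v i : ℂ)) ∈ 𝓞 := fun v ↦
    sum_mem fun i _ ↦ mul_mem (star_mem_eisenstein (hx i))
      (hH.1.mulVec (fun j ↦ (v j).2) i)
  let φ : (Fin (n + 2) → 𝓞) →ₗ[𝓞] 𝓞 :=
    { toFun := fun v ↦ ⟨_, hmem v⟩
      map_add' := fun v w ↦ Subtype.ext <| by
        simp only [AddMemClass.coe_add]
        rw [← dotProduct_add, ← mulVec_add]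
        rfl
      map_smul' := fun a v ↦ Subtype.ext <| by
        simp only [RingHom.id_apply, smul_eq_mul, MulMemClass.coe_mul]
        rw [← smul_eq_mul, ← dotProduct_smul, ← mulVec_smul]
        rfl }
  obtain ⟨b, hb0, hb⟩ := exists_basis_of_apply_eq_one (Pi.basisFun 𝓞 (Fin (n + 2))) φ
    (x := fun i ↦ ⟨x i, hx i⟩) (Subtype.ext h1)
  set B : Matrix (Fin (n + 2)) (Fin (n + 2)) 𝓞 := (Pi.basisFun 𝓞 (Fin (n + 2))).toMatrix b with hB
  set C : Matrix (Fin (n + 2)) (Fin (n + 2)) 𝓞 := b.toMatrix (Pi.basisFun 𝓞 (Fin (n + 2))) with hC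
  have hBC : B * C = 1 := Module.Basis.toMatrix_mul_toMatrix_flip _ _
  have hCB : C * B = 1 := Module.Basis.toMatrix_mul_toMatrix_flip _ _
  have hmap : ∀ X Y : Matrix (Fin (n + 2)) (Fin (n + 2)) 𝓞, X * Y = 1 →
      X.map ((↑) : 𝓞 → ℂ) * Y.map ((↑) : 𝓞 → ℂ) = 1 := fun X Y h ↦ by
    have h1 := congrArg (fun Z ↦ Z.map 𝓞.val) h
    rw [Matrix.map_mul] at h1
    exact h1.trans (Matrix.map_one _ rfl rfl)
  refine ⟨(B.map ((↑) : 𝓞 → ℂ))ᴴ * H * B.map ((↑) : 𝓞 → ℂ), ⟨(B.map ((↑) : 𝓞 → ℂ))ᴴ,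
    ⟨fun i j ↦ star_mem_eisenstein (B j i).2, (C.map ((↑) : 𝓞 → ℂ))ᴴ,
      fun i j ↦ star_mem_eisenstein (C j i).2, ?_, ?_⟩, by rw [conjTranspose_conjTranspose]⟩,
    1, one_pos, by omega, ?_⟩
  · rw [← conjTranspose_mul, hmap _ _ hCB, conjTranspose_one]
  · rw [← conjTranspose_mul, hmap _ _ hBC, conjTranspose_one]
  · have hent : ∀ i j, ((B.map ((↑) : 𝓞 → ℂ))ᴴ * H * B.map ((↑) : 𝓞 → ℂ)) i j =
        star (fun k ↦ (b i k : ℂ)) ⬝ᵥ H *ᵥ (fun k ↦ (b j k : ℂ)) := fun i j ↦ by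
      rw [Matrix.mul_assoc, Matrix.mul_apply]
      rfl
    have h0 : ∀ j : Fin (n + 2), j ≠ 0 →
        star (fun k ↦ (b 0 k : ℂ)) ⬝ᵥ H *ᵥ (fun k ↦ (b j k : ℂ)) = 0 := fun j hj ↦ by
      obtain ⟨i, rfl⟩ := Fin.exists_succ_eq.mpr hj
      rw [hb0]
      exact congrArg Subtype.val (hb i)
    rintro i j (⟨hi, hj⟩ | ⟨hi, hj⟩)
    · obtain rfl : i = 0 := Fin.ext (by simpa using hi)
      rw [hent]
      exact h0 j (by rintro rfl; exact hj (by simp))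
    · obtain rfl : j = 0 := Fin.ext (by simpa using hj)
      rw [hent, star_dotProduct_mulVec_symm hH.2.1, h0 i (by rintro rfl; exact hi (by simp)),
        star_zero]

theorem reprCount_one {n : ℕ} {H : Matrix (Fin (n + 2)) (Fin (n + 2)) ℂ}
    (hH : IsHermLattice H) (hind : ¬ Decomposable H) : reprCount H 1 = 0 := by
  have : IsEmpty {x : Fin (n + 2) → ℂ // IsLatVec x ∧ latNorm H x = ((1 : ℕ) : ℂ)} :=
    ⟨fun ⟨_, hx, h1⟩ ↦ hind (.of_norm_one hH hx (by rw [h1, Nat.cast_one]))⟩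
  exact Nat.card_of_isEmpty

theorem reprCount_three {H : Matrix (Fin 14) (Fin 14) ℂ} (hH : IsUnimodular H)
    (hind : ¬ Decomposable H) : reprCount H 3 = 17472 := by
  obtain ⟨φ, hφ, jφ⟩ := exists_isFricke_hasJet (reprCount H 2)
  have h := eq_zero_of_isFricke_of_hasJet ((isFricke_thetaSeries hH).add (hφ.const_mul (-1)))
    (c := reprCount H 3 - 17472) (by
      convert (hasJet_thetaSeries hH).add (jφ.const_mul (-1)) using 1
      · rw [reprCount_zero hH.1]; norm_num
      · rw [reprCount_one hH.1 hind]; norm_num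
      · ring
      · ring)
  exact_mod_cast sub_eq_zero.mp h

/-- Every indecomposable unimodular hermitian `𝓞`-lattice of rank 14 contains exactly
`17472 = 2⁶·3·7·13` vectors of norm 3. -/
theorem stmt_12 :
    ∀ H : Matrix (Fin 14) (Fin 14) ℂ,
      IsUnimodular H → ¬ Decomposable H →
      Nat.card {x : Fin 14 → ℂ // IsLatVec x ∧ latNorm H x = 3} = 2 ^ 6 * 3 * 7 * 13 := by
  intro H hH hind
  have h := reprCount_three hH hind
  rw [reprCount, Nat.cast_ofNat] at h
  norm_num [h]
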